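/- arXiv:1811.08733 — 2 statements merged into one kernel-verified Lean document; each statement's English description precedes it below -/
import Mathlib

section
/- Let n ≥ 0, let λ_1 > λ_2 > ⋯ > λ_{2n} ≥ 0 be integers (an extended strict partition of even length), and let c_1, …, c_{2n} be arbitrary sequences of complex numbers. Then the polynomial τ(t_1, t_3, t_5, …) = Pf( χ_{λ_i,λ_j}(t̃ + c_i, t̃ + c_j) )_{1≤i,j≤2n} satisfies the BKP bilinear identity. -/
/- ## Setup: the ring `B = ℂ[t₁,t₃,t₅,…]`, elementary Schur polynomials,
   vertex-operator coefficients, and the BKP bilinear identity. -/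

noncomputable section

open MvPolynomial

/-- The polynomial ring `B = ℂ[t₁,t₃,t₅,…]`; variable `i` represents `t_{2i+1}`. -/
abbrev BRing : Type := MvPolynomial ℕ ℂ

/-- The universal elementary Schur polynomials `s_n`, defined by
`exp (∑_{j≥1} t_j z^j) = ∑_{n≥0} s_n(t) z^n`; here the variable `j` (for `j ≥ 1`)
represents `t_j`.  They satisfy `s_0 = 1` and `(n+1) s_{n+1} = ∑_{j=1}^{n+1} j t_j s_{n+1-j}`. -/
def schurPoly : ℕ → MvPolynomial ℕ ℂ
  | 0 => 1
  | n + 1 =>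
      ((n + 1 : ℂ))⁻¹ •
        ∑ j ∈ Finset.range (n + 1),
          ((j + 1 : ℂ)) • (MvPolynomial.X (j + 1) * schurPoly (n - j))
  termination_by n => n
  decreasing_by omega

/-- `s_n(c)` for a complex sequence `c = (c_1, c_2, …)` (the entry `c 0` is ignored). -/
def sC (n : ℕ) (c : ℕ → ℂ) : ℂ := MvPolynomial.eval c (schurPoly n)

/-- `s_n` evaluated on a sequence of elements of `B`. -/
def sB (n : ℕ) (c : ℕ → BRing) : BRing := MvPolynomial.aeval c (schurPoly n)

/-- The sequence `t̃ = (t₁, 0, t₃, 0, t₅, 0, …)` of elements of `B`. -/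
def tTilde : ℕ → BRing := fun j => if j % 2 = 1 then MvPolynomial.X ((j - 1) / 2) else 0

/-- The sequence `t̃ + c` for a constant sequence `c`. -/
def tShift (c : ℕ → ℂ) : ℕ → BRing := fun j => tTilde j + MvPolynomial.C (c j)

/-- `s̃_m = s_m(t̃) ∈ B` for `m ≥ 0`, and `0` for `m < 0`; these are the coefficients of
`exp (∑_{j>0 odd} t_j z^j)`. -/
def sTildeZ (m : ℤ) : BRing :=
  if 0 ≤ m then MvPolynomial.aeval tTilde (schurPoly m.toNat) else 0

/-- `s_m(-t̃) ∈ B` for `m ≥ 0`, and `0` for `m < 0`; the coefficients of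
`exp (-∑_{j>0 odd} t_j z^j)`. -/
def sTildeNegZ (m : ℤ) : BRing :=
  if 0 ≤ m then MvPolynomial.aeval (fun j => -(tTilde j)) (schurPoly m.toNat) else 0

/-- `p(t₁ - 2w, t₃ - (2/3)w³, t₅ - (2/5)w⁵, …)` as a polynomial in `w` (which stands for
`z⁻¹`) over `B`: this is `exp (-2∑_{j>0 odd} (1/j) ∂/∂t_j z^{-j}) p` by Taylor's formula. -/
def shiftMinus (p : BRing) : Polynomial BRing :=
  MvPolynomial.aeval
    (fun i => Polynomial.C (MvPolynomial.X i) -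
      Polynomial.C (MvPolynomial.C ((2 : ℂ) / ((2 * i + 1 : ℕ) : ℂ))) *
        Polynomial.X ^ (2 * i + 1)) p

/-- `p(t₁ + 2w, t₃ + (2/3)w³, …)`, i.e. `exp (2∑_{j>0 odd} (1/j) ∂/∂t_j z^{-j}) p`. -/
def shiftPlus (p : BRing) : Polynomial BRing :=
  MvPolynomial.aeval
    (fun i => Polynomial.C (MvPolynomial.X i) +
      Polynomial.C (MvPolynomial.C ((2 : ℂ) / ((2 * i + 1 : ℕ) : ℂ))) *
        Polynomial.X ^ (2 * i + 1)) p

/-- The coefficient of `z^m` in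
`exp (∑_{j>0 odd} t_j z^j) exp (-2∑_{j>0 odd} (1/j)(∂/∂t_j) z^{-j}) τ`. -/
def leftCoeff (τ : BRing) (m : ℤ) : BRing :=
  ∑ᶠ k : ℕ, sTildeZ (m + k) * (shiftMinus τ).coeff k

/-- The coefficient of `z^m` in
`exp (-∑_{j>0 odd} t_j z^j) exp (2∑_{j>0 odd} (1/j)(∂/∂t_j) z^{-j}) τ`. -/
def rightCoeff (τ : BRing) (m : ℤ) : BRing :=
  ∑ᶠ k : ℕ, sTildeNegZ (m + k) * (shiftPlus τ).coeff k

/-- `ℂ[t₁,t₃,…] ⊗ ℂ[t'₁,t'₃,…]`, realized as polynomials in two families of variables. -/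
abbrev BRing2 : Type := MvPolynomial (ℕ ⊕ ℕ) ℂ

/-- The embedding `p(t) ↦ p(t) ∈ ℂ[t] ⊗ ℂ[t']` on the first factor. -/
def inL : BRing →+* BRing2 := (MvPolynomial.rename Sum.inl).toRingHom

/-- The embedding `p(t') ↦ p(t') ∈ ℂ[t] ⊗ ℂ[t']` on the second factor. -/
def inR : BRing →+* BRing2 := (MvPolynomial.rename Sum.inr).toRingHom

/-- The BKP bilinear identity on `τ ∈ ℂ[t₁,t₃,t₅,…]`: the coefficient of `z⁰` in
`(exp(∑ t_j z^j) exp(-2∑ (1/j)∂_{t_j} z^{-j}) τ)(t) ·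
 (exp(-∑ t'_j z^j) exp(2∑ (1/j)∂_{t'_j} z^{-j}) τ)(t')`
equals `τ(t) τ(t')` (all sums over odd `j > 0`; only finitely many summands below
are nonzero since `τ` is a polynomial). -/
def SatisfiesBKP (τ : BRing) : Prop :=
  ∑ᶠ m : ℤ, inL (leftCoeff τ m) * inR (rightCoeff τ (-m)) = inL τ * inR τ

/-- The MDKP bilinear identity on a pair `(τ₀, τ₁)`. -/
def SatisfiesMDKP (τ₀ τ₁ : BRing) : Prop :=
  ∑ᶠ m : ℤ, inL (leftCoeff τ₀ m) * inR (rightCoeff τ₁ (-m)) = inL τ₁ * inR τ₀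

/-- The condition on a permutation `σ` appearing in the definition of the Pfaffian:
`σ(2i-1) < σ(2i)` for all `i`, and `σ(1) < σ(3) < ⋯` (with 0-based indices here). -/
def pfaffianCond {m : ℕ} (σ : Equiv.Perm (Fin m)) : Prop :=
  (∀ i : Fin (m / 2),
      σ ⟨2 * i.val, by have := i.isLt; omega⟩ < σ ⟨2 * i.val + 1, by have := i.isLt; omega⟩) ∧
  (∀ i j : Fin (m / 2), i < j →
      σ ⟨2 * i.val, by have := i.isLt; omega⟩ < σ ⟨2 * j.val, by have := j.isLt; omega⟩)

open scoped Classical in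
/-- The Pfaffian `Pf(A) = ∑_σ sgn(σ) ∏_i a_{σ(2i-1),σ(2i)}` of a (skew-symmetric) matrix;
it is intended to be used for matrices of even size `m = 2n`. -/
def pfaffian {R : Type*} [CommRing R] {m : ℕ} (A : Matrix (Fin m) (Fin m) R) : R :=
  ∑ σ : Equiv.Perm (Fin m),
    if pfaffianCond σ then
      (Equiv.Perm.sign σ : ℤ) •
        ∏ i : Fin (m / 2),
          A (σ ⟨2 * i.val, by have := i.isLt; omega⟩)
            (σ ⟨2 * i.val + 1, by have := i.isLt; omega⟩)
    else 0

/-- The skew-symmetric matrix with `(i,j)`-entry `f i j` for `i < j`. -/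
def skewOf {R : Type*} [CommRing R] {m : ℕ} (f : Fin m → Fin m → R) :
    Matrix (Fin m) (Fin m) R :=
  Matrix.of fun i j => if i < j then f i j else if j < i then -f j i else 0

/-- `χ_{λ,μ}(c,c') = (1/2) s_λ(c) s_μ(c') + ∑_{ℓ=1}^{μ} (-1)^ℓ s_{λ+ℓ}(c) s_{μ-ℓ}(c')`,
for `λ > μ ≥ 0` and sequences `c, c'` of elements of `B`. -/
def chiB (l μ : ℕ) (c c' : ℕ → BRing) : BRing :=
  (2 : ℂ)⁻¹ • (sB l c * sB μ c') +
    ∑ ℓ ∈ Finset.Icc 1 μ, ((-1 : ℂ) ^ ℓ) • (sB (l + ℓ) c * sB (μ - ℓ) c')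

/-- The skew-symmetric matrix `( χ_{λ_i,λ_j}(t̃+c_i, t̃+c_j) )_{i,j}`. -/
def chiMatrix {m : ℕ} (lam : Fin m → ℕ) (c : Fin m → ℕ → ℂ) :
    Matrix (Fin m) (Fin m) BRing :=
  skewOf fun i j => chiB (lam i) (lam j) (tShift (c i)) (tShift (c j))

/-- `√2` as a complex number. -/
def sqrt2 : ℂ := (Real.sqrt 2 : ℂ)

/-- `ρ_{λ,μ}(c,c';b,b') = (s_λ(c)/√2 - b)(s_μ(c')/√2 + b')
  + ∑_{ℓ=1}^{μ} (-1)^ℓ s_{λ+ℓ}(c) s_{μ-ℓ}(c')` for `λ > μ ≥ 0`. -/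
def rhoB (l μ : ℕ) (c c' : ℕ → BRing) (b b' : ℂ) : BRing :=
  (sqrt2⁻¹ • sB l c - MvPolynomial.C b) * (sqrt2⁻¹ • sB μ c' + MvPolynomial.C b') +
    ∑ ℓ ∈ Finset.Icc 1 μ, ((-1 : ℂ) ^ ℓ) • (sB (l + ℓ) c * sB (μ - ℓ) c')

/-- `ρ_λ(c;b) = s_λ(c)/√2 + b`. -/
def rho1B (l : ℕ) (c : ℕ → BRing) (b : ℂ) : BRing :=
  sqrt2⁻¹ • sB l c + MvPolynomial.C b

/-- The `2n × 2n` skew-symmetric matrix `( ρ_{λ_i,λ_j}(t̃+c_i, t̃+c_j; b_i, b_j) )_{i,j}`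
(for an even number `m = 2n` of rows of `λ`). -/
def rhoMatrixEven {m : ℕ} (lam : Fin m → ℕ) (c : Fin m → ℕ → ℂ) (b : Fin m → ℂ) :
    Matrix (Fin m) (Fin m) BRing :=
  skewOf fun i j => rhoB (lam i) (lam j) (tShift (c i)) (tShift (c j)) (b i) (b j)

/-- For an odd number `m` of parts `λ_1 > ⋯ > λ_m ≥ 0`, the `(m+1) × (m+1)`
skew-symmetric matrix with rows/columns indexed by `0, 1, …, m`, whose `(0,j)`-entry is
`ρ_{λ_j}(t̃+c_j; b_j)` and whose `(i,j)`-entry for `1 ≤ i < j` is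
`ρ_{λ_i,λ_j}(t̃+c_i, t̃+c_j; b_i, b_j)`. -/
def rhoMatrixOdd {m : ℕ} (lam : Fin m → ℕ) (c : Fin m → ℕ → ℂ) (b : Fin m → ℂ) :
    Matrix (Fin (m + 1)) (Fin (m + 1)) BRing :=
  skewOf fun i j =>
    if i.val = 0 then
      if hj : j.val = 0 then 0
      else
        rho1B (lam ⟨j.val - 1, by have := j.isLt; omega⟩)
          (tShift (c ⟨j.val - 1, by have := j.isLt; omega⟩))
          (b ⟨j.val - 1, by have := j.isLt; omega⟩)
    else
      if hj : j.val = 0 then 0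
      else
        rhoB (lam ⟨i.val - 1, by have := i.isLt; omega⟩)
          (lam ⟨j.val - 1, by have := j.isLt; omega⟩)
          (tShift (c ⟨i.val - 1, by have := i.isLt; omega⟩))
          (tShift (c ⟨j.val - 1, by have := j.isLt; omega⟩))
          (b ⟨i.val - 1, by have := i.isLt; omega⟩)
          (b ⟨j.val - 1, by have := j.isLt; omega⟩)

/-- The DKP tau-function `ρ_λ(t̃; c_1,…,c_k; b_1,…,b_k)` attached to an extended strict
partition `λ` with `k` parts: a Pfaffian of size `k` if `k` is even, and of size `k+1`
(with an extra 0-th row built from the `ρ_{λ_j}`) if `k` is odd. -/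
def rhoTau {k : ℕ} (lam : Fin k → ℕ) (c : Fin k → ℕ → ℂ) (b : Fin k → ℂ) : BRing :=
  if k % 2 = 0 then pfaffian (rhoMatrixEven lam c b)
  else pfaffian (rhoMatrixOdd lam c b)

/-- The operators `φ̂_j` (`j ∈ ℤ`) on `B`, defined by the generating series
`∑_{j∈ℤ} φ̂_j z^{-j} = (1/√2) exp(∑_{k>0 odd} t_k z^k) exp(-∑_{k>0 odd} (2/k) ∂_{t_k} z^{-k})`. -/
def phiHat (j : ℤ) (p : BRing) : BRing :=
  sqrt2⁻¹ • ∑ᶠ k : ℕ, sTildeZ ((k : ℤ) - j) * (shiftMinus p).coeff k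

/-- `a : ℤ → ℂ` vanishes for all sufficiently negative indices. -/
def BddBelowSupport (a : ℤ → ℂ) : Prop := ∃ N : ℤ, ∀ j < N, a j = 0

/-- The operator `v = ∑_{j∈ℤ} a_j φ̂_j` on `B` (a finite sum on each polynomial,
when `a` has support bounded below). -/
def vOp (a : ℤ → ℂ) (p : BRing) : BRing := ∑ᶠ j : ℤ, a j • phiHat j p

/-- Evaluation at `t = 0`, `ev₀ : B → ℂ` (the vacuum expectation value). -/
def ev0 : BRing → ℂ := MvPolynomial.eval (fun _ => 0)

/-- The "`√2` times `φ̂_j`" vertex operator coefficients (without the `1/√2` factor),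
used for the type `D` construction. -/
def vertexB (j : ℤ) (p : BRing) : BRing :=
  ∑ᶠ k : ℕ, sTildeZ ((k : ℤ) - j) * (shiftMinus p).coeff k

/-- `B_D = ℂ[θ] ⊗ B` with `θ` a Grassmann variable: the pair `(p₀, p₁)` represents
`p₀ + θ p₁`. -/
abbrev BD : Type := BRing × BRing

/-- The operators `Φ̂_j` (`j ∈ ℤ`) on `B_D`, defined by
`∑_j Φ̂_j z^{-j} = (1/√2)(θ + ∂/∂θ) exp(∑ t_k z^k) exp(-∑ (2/k) ∂_{t_k} z^{-k})`. -/
def PhiHatD (j : ℤ) (p : BD) : BD :=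
  sqrt2⁻¹ • (vertexB j p.2, vertexB j p.1)

/-- `Ψ = (θ - ∂/∂θ)/√2` on `B_D`. -/
def PsiD (p : BD) : BD := sqrt2⁻¹ • (-p.2, p.1)

/-- The type `D` fermions `φ̂_a`, `a ∈ ½ + ℤ`, where the integer `m` encodes the
half-integer index `a = m + ½`:  `φ̂_{-i-½} = Φ̂_{-i}` and `φ̂_{i+½} = (-1)^i Φ̂_i`
for `i ≥ 1`, `φ̂_{-½} = (Φ̂_0 + Ψ)/√2`, `φ̂_{½} = (Φ̂_0 - Ψ)/√2`. -/
def phiD (m : ℤ) (p : BD) : BD :=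
  if m ≤ -2 then PhiHatD (m + 1) p
  else if m = -1 then sqrt2⁻¹ • (PhiHatD 0 p + PsiD p)
  else if m = 0 then sqrt2⁻¹ • (PhiHatD 0 p - PsiD p)
  else ((-1 : ℂ) ^ m) • PhiHatD m p

end

noncomputable section
open MvPolynomial
namespace BKPproof

section
/-! ### Elementary Schur polynomials -/


/-- `s_n` in a general algebra. -/
def sA {R : Type*} [CommRing R] [Algebra ℂ R] (a : ℕ → R) (n : ℕ) : R :=
  MvPolynomial.aeval a (schurPoly n)

section schur
variable {R : Type*} [CommRing R] [Algebra ℂ R]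

lemma sA_zero (a : ℕ → R) : sA a 0 = 1 := by
  simp [sA, schurPoly]

lemma sA_succ (a : ℕ → R) (n : ℕ) :
    ((n : R) + 1) * sA a (n + 1) =
      ∑ j ∈ Finset.range (n + 1), ((j : R) + 1) * a (j + 1) * sA a (n - j) := by
  have h : ((n : ℂ) + 1) ≠ 0 := by exact_mod_cast Nat.succ_ne_zero n
  have h2 : ((n : R) + 1) = algebraMap ℂ R ((n : ℂ) + 1) := by simp
  rw [sA, schurPoly, map_smul, h2, ← Algebra.smul_def, smul_smul, mul_inv_cancel₀ h, one_smul,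
    map_sum]
  refine Finset.sum_congr rfl fun j _ => ?_
  rw [map_smul, map_mul, MvPolynomial.aeval_X, Algebra.smul_def, sA]
  simp [mul_assoc]

lemma natCast_mul_cancel (n : ℕ) {x y : R} (h : ((n : R) + 1) * x = ((n : R) + 1) * y) :
    x = y := by
  have h0 : ((n : ℂ) + 1) ≠ 0 := by exact_mod_cast Nat.succ_ne_zero n
  have h2 : ((n : R) + 1) = algebraMap ℂ R ((n : ℂ) + 1) := by simp
  rw [h2, ← Algebra.smul_def, ← Algebra.smul_def] at h
  have := congrArg (fun z => ((n : ℂ) + 1)⁻¹ • z) h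
  simpa only [smul_smul, inv_mul_cancel₀ h0, one_smul] using this

/-- uniqueness for the recursion -/
lemma rec_unique (b u w : ℕ → R) (h0 : u 0 = w 0)
    (g : ℕ → R)
    (hu : ∀ n : ℕ, ((n : R) + 1) * u (n + 1) =
      g n + ∑ j ∈ Finset.range (n + 1), ((j : R) + 1) * b (j + 1) * u (n - j))
    (hw : ∀ n : ℕ, ((n : R) + 1) * w (n + 1) =
      g n + ∑ j ∈ Finset.range (n + 1), ((j : R) + 1) * b (j + 1) * w (n - j)) (n : ℕ) :
    u n = w n := by
  induction n using Nat.strong_induction_on with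
  | _ n ih =>
    cases n with
    | zero => exact h0
    | succ n =>
      apply natCast_mul_cancel n
      rw [hu, hw]
      congr 1
      refine Finset.sum_congr rfl fun j hj => ?_
      rw [ih (n - j) (by omega)]

lemma sA_unique (b u : ℕ → R) (h0 : u 0 = 1)
    (hu : ∀ n : ℕ, ((n : R) + 1) * u (n + 1) =
      ∑ j ∈ Finset.range (n + 1), ((j : R) + 1) * b (j + 1) * u (n - j)) (n : ℕ) :
    sA b n = u n :=
  rec_unique b (sA b) u (by rw [h0, sA_zero]) (fun _ => 0)
    (fun n => by rw [sA_succ]; simp) (fun n => by rw [hu]; simp) n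

open PowerSeries in
lemma sA_ode (a : ℕ → R) :
    PowerSeries.derivative R (PowerSeries.mk (sA a)) =
      PowerSeries.mk (fun j => ((j : R) + 1) * a (j + 1)) * PowerSeries.mk (sA a) := by
  ext n
  rw [PowerSeries.coeff_derivative, PowerSeries.coeff_mul,
    Finset.Nat.sum_antidiagonal_eq_sum_range_succ
      (fun i j => PowerSeries.coeff i (PowerSeries.mk (fun j => ((j : R) + 1) * a (j + 1))) *
        PowerSeries.coeff j (PowerSeries.mk (sA a)))]
  simp only [PowerSeries.coeff_mk]
  rw [mul_comm, sA_succ]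

lemma sA_add (a b : ℕ → R) (n : ℕ) :
    sA (fun j => a j + b j) n = ∑ k ∈ Finset.range (n + 1), sA a k * sA b (n - k) := by
  have key := sA_unique (fun j => a j + b j)
    (fun n => PowerSeries.coeff n (PowerSeries.mk (sA a) * PowerSeries.mk (sA b)))
    (by simp [sA_zero]) (fun n => ?_) n
  · rw [key, PowerSeries.coeff_mul, Finset.Nat.sum_antidiagonal_eq_sum_range_succ
      (fun i j => PowerSeries.coeff i (PowerSeries.mk (sA a)) *
        PowerSeries.coeff j (PowerSeries.mk (sA b)))]
    simp
  · have h : PowerSeries.derivative R (PowerSeries.mk (sA a) * PowerSeries.mk (sA b)) =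
        PowerSeries.mk (fun j => ((j : R) + 1) * (a (j + 1) + b (j + 1))) *
          (PowerSeries.mk (sA a) * PowerSeries.mk (sA b)) := by
      have : PowerSeries.mk (fun j => ((j : R) + 1) * (a (j + 1) + b (j + 1))) =
          PowerSeries.mk (fun j => ((j : R) + 1) * a (j + 1)) +
          PowerSeries.mk (fun j => ((j : R) + 1) * b (j + 1)) := by
        ext; simp [mul_add]
      rw [Derivation.leibniz, sA_ode, sA_ode, this, smul_eq_mul, smul_eq_mul]
      ring
    have h' := congrArg (PowerSeries.coeff n) h
    rw [PowerSeries.coeff_derivative, PowerSeries.coeff_mul (n := n) (φ := PowerSeries.mk _),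
      Finset.Nat.sum_antidiagonal_eq_sum_range_succ
      (fun i j => PowerSeries.coeff i
          (PowerSeries.mk (fun j => ((j : R) + 1) * (a (j + 1) + b (j + 1)))) *
        PowerSeries.coeff j (PowerSeries.mk (sA a) * PowerSeries.mk (sA b)))] at h'
    rw [mul_comm, h']
    simp only [PowerSeries.coeff_mk]

lemma sA_scale (u : R) (a : ℕ → R) (n : ℕ) :
    sA (fun j => u ^ j * a j) n = u ^ n * sA a n := by
  refine sA_unique _ (fun n => u ^ n * sA a n) (by simp [sA_zero]) (fun n => ?_) n
  rw [mul_left_comm, sA_succ, Finset.mul_sum]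
  refine Finset.sum_congr rfl fun j hj => ?_
  have : u ^ (n + 1) = u ^ (j + 1) * u ^ (n - j) := by
    rw [← pow_add]; congr 1; have := Finset.mem_range.1 hj; omega
  rw [this]; ring

lemma sA_map {R' : Type*} [CommRing R'] [Algebra ℂ R'] (φ : R →ₐ[ℂ] R') (a : ℕ → R) (n : ℕ) :
    φ (sA a n) = sA (fun j => φ (a j)) n := by
  unfold sA
  rw [← AlgHom.comp_apply, MvPolynomial.comp_aeval]

/-- The coefficients of `(1-u)/(1+u)`. -/
def ff (n : ℕ) : ℂ := if n = 0 then 1 else 2 * (-1) ^ n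

lemma ff_rec (n : ℕ) : ((n : ℂ) + 1) * ff (n + 1) =
    ∑ j ∈ Finset.range (n + 1), (if j % 2 = 0 then (-2 : ℂ) else 0) * ff (n - j) := by
  induction n using Nat.strong_induction_on with
  | _ n ih =>
    match n with
    | 0 => simp [ff]
    | 1 => norm_num [ff, Finset.sum_range_succ]
    | n + 2 =>
      rw [Finset.sum_range_succ', Finset.sum_range_succ']
      have h := ih n (by omega)
      have e : ∀ k ∈ Finset.range (n + 1),
          (if (k + 1 + 1) % 2 = 0 then (-2 : ℂ) else 0) * ff (n + 2 - (k + 1 + 1)) =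
          (if k % 2 = 0 then (-2 : ℂ) else 0) * ff (n - k) := by
        intro k _
        have e1 : (k + 1 + 1) % 2 = k % 2 := by omega
        have e2 : n + 2 - (k + 1 + 1) = n - k := by omega
        rw [e1, e2]
      rw [Finset.sum_congr rfl e, ← h]
      simp [ff, pow_succ]
      ring

lemma sA_ff (b : ℕ → R) (X : R)
    (hb : ∀ j, b j = if j % 2 = 1 then -(algebraMap ℂ R (2 / (j : ℂ)) * X ^ j) else 0) (n : ℕ) :
    sA b n = algebraMap ℂ R (ff n) * X ^ n := by
  refine sA_unique _ (fun n => algebraMap ℂ R (ff n) * X ^ n) (by simp [ff]) (fun n => ?_) n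
  have h := congrArg (algebraMap ℂ R) (ff_rec n)
  rw [map_mul, map_add, map_natCast, map_one, map_sum] at h
  rw [← mul_assoc, h, Finset.sum_mul]
  refine Finset.sum_congr rfl fun j hj => ?_
  have hp : X ^ (n + 1) = X ^ (j + 1) * X ^ (n - j) := by
    rw [← pow_add]; congr 1; have := Finset.mem_range.1 hj; omega
  rw [hb, hp]
  by_cases hj2 : j % 2 = 0
  · have h1 : (j + 1) % 2 = 1 := by omega
    have h0 : ((j : ℂ) + 1) ≠ 0 := by exact_mod_cast Nat.succ_ne_zero j
    have h3 : ((j : R) + 1) * algebraMap ℂ R (2 / ((j + 1 : ℕ) : ℂ)) = 2 := by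
      have : ((j : R) + 1) = algebraMap ℂ R ((j : ℂ) + 1) := by simp
      rw [this, ← map_mul]
      rw [Nat.cast_add, Nat.cast_one, mul_div_cancel₀ _ h0, map_ofNat]
    simp only [hj2, h1, if_true, map_mul, map_neg]
    have : algebraMap ℂ R 2 = 2 := map_ofNat _ 2
    rw [this]
    linear_combination (X ^ (j + 1) * algebraMap ℂ R (ff (n - j)) * X ^ (n - j)) * h3
  · have h1 : ¬ (j + 1) % 2 = 1 := by omega
    simp [hj2, h1]

end schur
end

section
/-! ### Vertex operators -/

lemma sTildeZ_natCast (n : ℕ) : sTildeZ (n : ℤ) = sA tTilde n := by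
  simp [sTildeZ, sA]

lemma sTildeZ_neg {m : ℤ} (h : m < 0) : sTildeZ m = 0 := by
  simp [sTildeZ, not_le.2 h]

lemma sTildeZ_zero : sTildeZ 0 = 1 := by
  have := sTildeZ_natCast 0
  rw [sA_zero] at this
  exact_mod_cast this

lemma pderiv_tTilde (i j : ℕ) :
    pderiv i (tTilde j) = if j = 2 * i + 1 then 1 else 0 := by
  unfold tTilde
  by_cases h : j % 2 = 1
  · rw [if_pos h]
    by_cases h2 : j = 2 * i + 1
    · rw [if_pos h2]
      have : (j - 1) / 2 = i := by omega
      rw [this, pderiv_X_self]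
    · rw [if_neg h2, pderiv_X_of_ne]
      omega
  · have h2 : ¬ j = 2 * i + 1 := by omega
    rw [if_neg h, if_neg h2, map_zero]

lemma pderiv_sA_tTilde (i n : ℕ) :
    pderiv i (sA tTilde n) = if 2 * i + 1 ≤ n then sA tTilde (n - (2 * i + 1)) else 0 := by
  refine rec_unique tTilde (fun n => pderiv i (sA tTilde n))
    (fun n => if 2 * i + 1 ≤ n then sA tTilde (n - (2 * i + 1)) else 0)
    (by simp [sA_zero])
    (fun n => if 2 * i ≤ n then ((2 * i : ℕ) + 1) * sA tTilde (n - 2 * i) else 0) ?_ ?_ n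
  · intro n
    have h := congrArg (pderiv i) (sA_succ tTilde n)
    have hc : ∀ k : ℕ, pderiv i ((k : BRing) + 1) = 0 := by
      intro k
      rw [map_add, pderiv_one, Derivation.map_natCast, add_zero]
    rw [pderiv_mul, hc, zero_mul, zero_add] at h
    rw [h, map_sum]
    have : ∀ j ∈ Finset.range (n + 1), pderiv i (((j : BRing) + 1) * tTilde (j + 1) * sA tTilde (n - j))
       = (if j = 2 * i then ((j : BRing) + 1) * sA tTilde (n - j) else 0) +
        ((j : BRing) + 1) * tTilde (j + 1) * pderiv i (sA tTilde (n - j)) := by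
      intro j _
      rw [pderiv_mul, pderiv_mul, hc, zero_mul, zero_add, pderiv_tTilde]
      by_cases hj : j = 2 * i
      · simp [hj]
      · simp [hj]
    rw [Finset.sum_congr rfl this, Finset.sum_add_distrib, Finset.sum_ite_eq']
    simp
  · intro n
    by_cases h : 2 * i ≤ n
    · obtain ⟨N, rfl⟩ := Nat.exists_eq_add_of_le h
      have e1 : 2 * i + 1 ≤ 2 * i + N + 1 := by omega
      have e2 : 2 * i + N + 1 - (2 * i + 1) = N := by omega
      have e3 : 2 * i + N - 2 * i = N := by omega
      simp only [e1, e2, h, e3, if_true]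
      have hs : ∑ j ∈ Finset.range (2 * i + N + 1), ((j : BRing) + 1) * tTilde (j + 1) *
          (if 2 * i + 1 ≤ 2 * i + N - j then sA tTilde (2 * i + N - j - (2 * i + 1)) else 0) =
          ∑ j ∈ Finset.range N, ((j : BRing) + 1) * tTilde (j + 1) * sA tTilde (N - 1 - j) := by
        symm
        refine Finset.sum_subset_zero_on_sdiff ?_ ?_ ?_
        · intro x; simp only [Finset.mem_range]; omega
        · intro x hx
          simp only [Finset.mem_sdiff, Finset.mem_range] at hx
          rw [if_neg (by omega), mul_zero]
        · intro x hx
          have := Finset.mem_range.1 hx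
          rw [if_pos (by omega)]
          congr 2
          omega
      rw [hs]
      cases N with
      | zero => simp
      | succ N =>
        have := sA_succ tTilde N
        simp only [Nat.add_sub_cancel]
        rw [← this]
        push_cast
        ring
    · rw [if_neg (by omega), if_neg h, mul_zero, zero_add, Finset.sum_eq_zero]
      intro j _
      rw [if_neg (by omega), mul_zero]

lemma pderiv_sTildeZ (i : ℕ) (m : ℤ) :
    pderiv i (sTildeZ m) = sTildeZ (m - (2 * i + 1 : ℕ)) := by
  by_cases hm : m < 0
  · rw [sTildeZ_neg hm, sTildeZ_neg (by omega), map_zero]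
  · obtain ⟨n, rfl⟩ := Int.eq_ofNat_of_zero_le (not_lt.1 hm)
    rw [sTildeZ_natCast, pderiv_sA_tTilde]
    split_ifs with h
    · rw [← sTildeZ_natCast]; congr 1; omega
    · rw [sTildeZ_neg]; omega

/-- Generic pairing. -/
def Lgen (ε : ℤ → BRing) (m : ℤ) : Polynomial BRing →ₗ[ℂ] BRing :=
  Polynomial.lsum (fun k => LinearMap.mulLeft ℂ (ε (m + k)))

lemma Lgen_monomial (ε : ℤ → BRing) (m : ℤ) (k : ℕ) (x : BRing) :
    Lgen ε m (Polynomial.monomial k x) = ε (m + k) * x := by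
  simp [Lgen, Polynomial.lsum_apply, Polynomial.sum_monomial_index]

lemma Lgen_apply (ε : ℤ → BRing) (m : ℤ) (P : Polynomial BRing) :
    Lgen ε m P = ∑ᶠ k : ℕ, ε (m + k) * P.coeff k := by
  rw [finsum_eq_sum_of_support_subset (s := P.support)]
  · simp [Lgen, Polynomial.lsum_apply, Polynomial.sum_def]
  · intro k hk
    simp only [Function.mem_support] at hk
    simp only [Finset.mem_coe, Polynomial.mem_support_iff]
    intro h
    exact hk (by rw [h, mul_zero])

lemma Lgen_C_mul (ε : ℤ → BRing) (m : ℤ) (x : BRing) (P : Polynomial BRing) :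
    Lgen ε m (Polynomial.C x * P) = x * Lgen ε m P := by
  induction P using Polynomial.induction_on' with
  | add p q hp hq => rw [mul_add, map_add, hp, hq, map_add, mul_add]
  | monomial k y =>
    rw [Polynomial.C_mul_monomial, Lgen_monomial, Lgen_monomial]; ring

lemma Lgen_mul_X_pow (ε : ℤ → BRing) (m : ℤ) (j : ℕ) (P : Polynomial BRing) :
    Lgen ε m (P * Polynomial.X ^ j) = Lgen ε (m + j) P := by
  induction P using Polynomial.induction_on' with
  | add p q hp hq => rw [add_mul, map_add, hp, hq, map_add]
  | monomial k y =>
    rw [Polynomial.monomial_mul_X_pow, Lgen_monomial, Lgen_monomial]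
    congr 2; push_cast; ring

lemma Lgen_vanish (ε : ℤ → BRing) (hε : ∀ m < 0, ε m = 0) (P : Polynomial BRing) :
    ∃ N : ℤ, ∀ m < N, Lgen ε m P = 0 := by
  induction P using Polynomial.induction_on' with
  | add p q hp hq =>
    obtain ⟨N, hN⟩ := hp
    obtain ⟨M, hM⟩ := hq
    refine ⟨min N M, fun m hm => ?_⟩
    rw [map_add, hN m (lt_of_lt_of_le hm (min_le_left _ _)),
      hM m (lt_of_lt_of_le hm (min_le_right _ _)), add_zero]
  | monomial k y =>
    refine ⟨-k, fun m hm => ?_⟩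
    rw [Lgen_monomial, hε _ (by omega), zero_mul]

/-- The constant `2/(2i+1)`. -/
def cc (i : ℕ) : ℂ := (2 : ℂ) / ((2 * i + 1 : ℕ) : ℂ)

/-- `shiftMinus` as an algebra homomorphism. -/
def Dm : BRing →ₐ[ℂ] Polynomial BRing :=
  MvPolynomial.aeval
    (fun i => Polynomial.C (MvPolynomial.X i) -
      Polynomial.C (MvPolynomial.C ((2 : ℂ) / ((2 * i + 1 : ℕ) : ℂ))) *
        Polynomial.X ^ (2 * i + 1))

/-- `shiftPlus` as an algebra homomorphism. -/
def Dp : BRing →ₐ[ℂ] Polynomial BRing :=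
  MvPolynomial.aeval
    (fun i => Polynomial.C (MvPolynomial.X i) +
      Polynomial.C (MvPolynomial.C ((2 : ℂ) / ((2 * i + 1 : ℕ) : ℂ))) *
        Polynomial.X ^ (2 * i + 1))

lemma Dm_X (i : ℕ) : Dm (X i) = Polynomial.C (X i) -
      Polynomial.C (C (cc i)) * Polynomial.X ^ (2 * i + 1) := by
  simp only [Dm, MvPolynomial.aeval_X]; rfl

lemma Dp_X (i : ℕ) : Dp (X i) = Polynomial.C (X i) +
      Polynomial.C (C (cc i)) * Polynomial.X ^ (2 * i + 1) := by
  simp only [Dp, MvPolynomial.aeval_X]; rfl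

/-- The vertex operator modes. -/
def G (m : ℤ) : BRing →ₗ[ℂ] BRing := (Lgen sTildeZ m).comp Dm.toLinearMap

/-- The dual vertex operator modes. -/
def Gr (m : ℤ) : BRing →ₗ[ℂ] BRing := (Lgen sTildeNegZ m).comp Dp.toLinearMap

lemma leftCoeff_eq (p : BRing) (m : ℤ) : leftCoeff p m = G m p := by
  rw [leftCoeff, G, LinearMap.comp_apply, Lgen_apply]; rfl

lemma rightCoeff_eq' (p : BRing) (m : ℤ) : rightCoeff p m = Gr m p := by
  rw [rightCoeff, Gr, LinearMap.comp_apply, Lgen_apply]; rfl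

lemma G_apply (m : ℤ) (p : BRing) : G m p = Lgen sTildeZ m (Dm p) := rfl
lemma Gr_apply (m : ℤ) (p : BRing) : Gr m p = Lgen sTildeNegZ m (Dp p) := rfl

lemma G_one (m : ℤ) : G m 1 = sTildeZ m := by
  rw [G_apply, map_one, ← Polynomial.C_1, ← Polynomial.monomial_zero_left, Lgen_monomial]; simp

lemma Gr_one (m : ℤ) : Gr m 1 = sTildeNegZ m := by
  rw [Gr_apply, map_one, ← Polynomial.C_1, ← Polynomial.monomial_zero_left, Lgen_monomial]; simp

lemma G_X_mul (m : ℤ) (i : ℕ) (p : BRing) :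
    G m (X i * p) = X i * G m p - cc i • G (m + (2 * i + 1 : ℕ)) p := by
  rw [G_apply, map_mul, Dm_X, sub_mul, map_sub, Lgen_C_mul, mul_assoc, Lgen_C_mul, mul_comm (_ ^ _),
    Lgen_mul_X_pow, ← smul_eq_C_mul]; rfl

lemma Gr_X_mul (m : ℤ) (i : ℕ) (p : BRing) :
    Gr m (X i * p) = X i * Gr m p + cc i • Gr (m + (2 * i + 1 : ℕ)) p := by
  rw [Gr_apply, map_mul, Dp_X, add_mul, map_add, Lgen_C_mul, mul_assoc, Lgen_C_mul,
    mul_comm (_ ^ _), Lgen_mul_X_pow, ← smul_eq_C_mul]; rfl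

lemma G_vanish (p : BRing) : ∃ N : ℤ, ∀ m < N, G m p = 0 :=
  Lgen_vanish _ (fun _ h => sTildeZ_neg h) _

/-- Induction principle for linear operators. -/
lemma op_induction {motive : BRing → Prop} (p : BRing) (h1 : motive 1)
    (hs : ∀ (c : ℂ) p, motive p → motive (c • p))
    (ha : ∀ p q, motive p → motive q → motive (p + q))
    (hX : ∀ i p, motive p → motive (X i * p)) : motive p := by
  induction p using MvPolynomial.induction_on with
  | C a =>
    have := hs a 1 h1
    rwa [smul_eq_C_mul, mul_one] at this
  | add p q hp hq => exact ha p q hp hq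
  | mul_X p n hp => rw [mul_comm]; exact hX n p hp

lemma zpow_odd (m : ℤ) (i : ℕ) : (-1 : ℂ) ^ (m + (2 * i + 1 : ℕ)) = - (-1 : ℂ) ^ m := by
  rw [zpow_add₀ (by norm_num), zpow_natCast, pow_succ, pow_mul]; norm_num

lemma zpow_neg_one (m : ℤ) : (-1 : ℂ) ^ (-m) = (-1 : ℂ) ^ m := by
  rw [zpow_neg, ← inv_zpow]; norm_num

lemma zpow_sq (m : ℤ) : (-1 : ℂ) ^ m * (-1 : ℂ) ^ m = 1 := by
  rw [← mul_zpow]; norm_num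

lemma sTildeNegZ_eq (m : ℤ) : sTildeNegZ m = (-1 : ℂ) ^ m • sTildeZ m := by
  unfold sTildeNegZ sTildeZ
  split_ifs with h
  · obtain ⟨n, rfl⟩ := Int.eq_ofNat_of_zero_le h
    have h1 := sA_scale (-1 : BRing) tTilde n
    have h2 : (fun j => (-1 : BRing) ^ j * tTilde j) = fun j => - tTilde j := by
      funext j
      unfold tTilde
      split_ifs with hj
      · rw [Odd.neg_one_pow (Nat.odd_iff.2 hj)]; ring
      · simp
    rw [h2] at h1
    simp only [Int.toNat_natCast, zpow_natCast]
    unfold sA at h1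
    rw [h1, smul_eq_C_mul]
    simp
  · simp

lemma Gr_eq (m : ℤ) (p : BRing) : Gr m p = (-1 : ℂ) ^ m • G m p := by
  induction p using op_induction generalizing m with
  | h1 => rw [Gr_one, G_one, sTildeNegZ_eq]
  | hs c p h => rw [map_smul, map_smul, h, smul_comm]
  | ha p q hp hq => rw [map_add, map_add, hp, hq, smul_add]
  | hX i p h =>
    rw [Gr_X_mul, G_X_mul, h, h, zpow_odd]
    simp only [smul_sub, neg_smul, smul_neg, mul_smul_comm]
    rw [smul_comm (cc i), sub_eq_add_neg]

lemma pderiv_G (i : ℕ) (m : ℤ) (p : BRing) :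
    pderiv i (G m p) = G m (pderiv i p) + G (m - (2 * i + 1 : ℕ)) p := by
  induction p using op_induction generalizing m with
  | h1 => rw [G_one, G_one, pderiv_one, map_zero, zero_add, pderiv_sTildeZ]
  | hs c p h => simp only [map_smul, h, smul_add, Derivation.map_smul]
  | ha p q hp hq => rw [map_add, map_add, hp, hq, map_add, map_add, map_add]; ring
  | hX l p h =>
    rw [G_X_mul, map_sub, Derivation.map_smul, pderiv_mul, pderiv_mul, h, h, map_add, G_X_mul,
      G_X_mul]
    have e1 : G m (pderiv i (X l) * p) = pderiv i (X l) * G m p := by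
      rw [pderiv_X]
      by_cases hl : i = l
      · subst hl; simp
      · rw [Pi.single_eq_of_ne (by tauto)]; simp
    have e2 : m + (2 * l + 1 : ℕ) - (2 * i + 1 : ℕ) = m - (2 * i + 1 : ℕ) + (2 * l + 1 : ℕ) := by
      ring
    rw [e1, e2, smul_add]
    ring

/-- vanishing criterion via derivatives -/
lemma vanish_of_closed (S : Submodule ℂ BRing) (h0 : ∀ p ∈ S, constantCoeff p = 0)
    (hd : ∀ p ∈ S, ∀ i, pderiv i p ∈ S) (p : BRing) (hp : p ∈ S) : p = 0 := by
  have key : ∀ (d : ℕ) (m : ℕ →₀ ℕ), m.degree = d → ∀ p ∈ S, coeff m p = 0 := by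
    intro d
    induction d with
    | zero =>
      intro m hm p hp
      rw [Finsupp.degree_eq_zero_iff] at hm
      subst hm
      exact h0 p hp
    | succ d ih =>
      intro m hm p hp
      have hne : m ≠ 0 := by rintro rfl; simp at hm
      obtain ⟨i, hi⟩ := Finsupp.ne_iff.1 hne
      have hle : Finsupp.single i 1 ≤ m := by
        rw [Finsupp.single_le_iff]
        simp at hi; omega
      obtain ⟨m', rfl⟩ := exists_add_of_le hle
      rw [map_add, Finsupp.degree_single] at hm
      have := ih m' (by omega) _ (hd p hp i)
      rw [coeff_pderiv] at this
      rw [add_comm]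
      simpa [Nat.cast_add_one_ne_zero] using this
  ext m
  rw [key _ m rfl p hp, coeff_zero]
end

section
/-! ### The Clifford relations -/

lemma Dm_sA (n : ℕ) : Dm (sA tTilde n) =
    ∑ k ∈ Finset.range (n + 1), Polynomial.monomial k (ff k • sA tTilde (n - k)) := by
  rw [sA_map]
  have h : (fun j => Dm (tTilde j)) = fun j : ℕ =>
      (if j % 2 = 1 then -(algebraMap ℂ (Polynomial BRing) (2 / (j : ℂ)) * Polynomial.X ^ j) else 0)
      + Polynomial.C (tTilde j) := by
    funext j
    unfold tTilde
    split_ifs with hj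
    · rw [Dm_X]
      have : 2 * ((j - 1) / 2) + 1 = j := by omega
      rw [cc, this, sub_eq_add_neg, add_comm]
      rfl
    · simp
  rw [h, sA_add]
  refine Finset.sum_congr rfl fun k _ => ?_
  rw [sA_ff _ Polynomial.X (fun j => rfl)]
  have h2 := sA_map (Algebra.ofId BRing (Polynomial BRing) |>.restrictScalars ℂ) tTilde (n - k)
  have h3 : sA (fun j => Polynomial.C (tTilde j)) (n - k) = Polynomial.C (sA tTilde (n - k)) :=
    h2.symm
  rw [h3, ← Polynomial.C_mul_X_pow_eq_monomial, smul_eq_C_mul, Polynomial.C_mul]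
  have h4 : algebraMap ℂ (Polynomial BRing) (ff k) = Polynomial.C (C (ff k)) := rfl
  rw [h4]; ring

lemma GG_one (m n : ℤ) (N : ℕ) (h : n ≤ N) :
    G m (G n 1) = ∑ k ∈ Finset.range (N + 1), ff k • (sTildeZ (m + k) * sTildeZ (n - k)) := by
  rw [G_one]
  by_cases hn : n < 0
  · rw [sTildeZ_neg hn, map_zero, Finset.sum_eq_zero]
    intro k _
    rw [sTildeZ_neg (m := n - k) (by omega), mul_zero, smul_zero]
  · obtain ⟨n, rfl⟩ := Int.eq_ofNat_of_zero_le (not_lt.1 hn)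
    rw [sTildeZ_natCast, G_apply, Dm_sA, map_sum]
    refine Finset.sum_subset_zero_on_sdiff ?_ ?_ ?_
    · intro x; simp only [Finset.mem_range]; omega
    · intro x hx
      simp only [Finset.mem_sdiff, Finset.mem_range] at hx
      rw [sTildeZ_neg (m := (n : ℤ) - x) (by omega), mul_zero, smul_zero]
    · intro x hx
      have := Finset.mem_range.1 hx
      rw [Lgen_monomial, mul_smul_comm, ← sTildeZ_natCast, Nat.cast_sub (by omega)]

lemma cc_sA_tTilde (n : ℕ) : constantCoeff (sA tTilde (n + 1)) = 0 := by
  apply natCast_mul_cancel n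
  have h := congrArg constantCoeff (sA_succ tTilde n)
  rw [map_mul, map_add, map_natCast, map_one, map_sum] at h
  rw [h, mul_zero, Finset.sum_eq_zero]
  intro j _
  have : constantCoeff (tTilde (j + 1)) = 0 := by
    unfold tTilde; split_ifs <;> simp
  rw [map_mul, map_mul, this]; simp

lemma cc_sTildeZ (m : ℤ) : constantCoeff (sTildeZ m) = if m = 0 then 1 else 0 := by
  split_ifs with h
  · rw [h, sTildeZ_zero, map_one]
  · by_cases hm : m < 0
    · rw [sTildeZ_neg hm, map_zero]
    · obtain ⟨n, rfl⟩ := Int.eq_ofNat_of_zero_le (not_lt.1 hm)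
      rw [sTildeZ_natCast]
      cases n with
      | zero => simp at h
      | succ n => exact cc_sA_tTilde n

lemma cc_smul (c : ℂ) (p : BRing) : constantCoeff (c • p) = c * constantCoeff p := by
  rw [smul_eq_C_mul, map_mul, constantCoeff_C]

lemma cc_G_pos (m : ℤ) (hm : 0 < m) (p : BRing) : constantCoeff (G m p) = 0 := by
  induction p using op_induction generalizing m with
  | h1 => rw [G_one, cc_sTildeZ, if_neg hm.ne']
  | hs c p h => rw [map_smul, cc_smul, h m hm, mul_zero]
  | ha p q hp hq => rw [map_add, map_add, hp m hm, hq m hm, add_zero]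
  | hX i p h =>
    rw [G_X_mul, map_sub, map_mul, cc_smul, h m hm, h (m + (2 * i + 1 : ℕ)) (by omega)]; simp

lemma cc_G_zero (p : BRing) : constantCoeff (G 0 p) = constantCoeff p := by
  induction p using op_induction with
  | h1 => rw [G_one, sTildeZ_zero]
  | hs c p h => rw [map_smul, cc_smul, h, cc_smul]
  | ha p q hp hq => rw [map_add, map_add, hp, hq, map_add]
  | hX i p h =>
    rw [G_X_mul, map_sub, map_mul, cc_smul, cc_G_pos (0 + (2 * i + 1 : ℕ)) (by omega)]; simp

/-- The scalar in the anticommutator. -/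
def bb (m n : ℤ) : ℂ := if m + n = 0 then 2 * (-1 : ℂ) ^ m else 0

lemma cc_GG (m n : ℤ) : constantCoeff (G m (G n 1)) =
    if m + n = 0 then (if 0 ≤ n then ff n.toNat else 0) else 0 := by
  by_cases hn : n < 0
  · rw [G_one, sTildeZ_neg hn, map_zero, map_zero]
    simp [not_le.2 hn]
  · obtain ⟨n, rfl⟩ := Int.eq_ofNat_of_zero_le (not_lt.1 hn)
    rw [GG_one m n n le_rfl, map_sum, Finset.sum_eq_single n]
    · rw [cc_smul, map_mul, cc_sTildeZ, cc_sTildeZ]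
      simp
    · intro k _ hk
      rw [cc_smul, map_mul, cc_sTildeZ, cc_sTildeZ, if_neg (c := (n : ℤ) - k = 0) (by omega)]
      simp
    · simp

lemma anti_one (m n : ℤ) : G m (G n 1) + G n (G m 1) - C (bb m n) = 0 := by
  refine vanish_of_closed (Submodule.span ℂ
    (Set.range fun q : ℤ × ℤ => G q.1 (G q.2 1) + G q.2 (G q.1 1) - C (bb q.1 q.2))) ?_ ?_ _
    (Submodule.subset_span ⟨(m, n), rfl⟩)
  · intro p hp
    induction hp using Submodule.span_induction with
    | mem x hx =>
      obtain ⟨⟨m, n⟩, rfl⟩ := hx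
      simp only
      rw [map_sub, map_add, cc_GG, cc_GG, constantCoeff_C, bb, add_comm n m]
      split_ifs with h1 h2 h3 h3
      · have : m = 0 := by omega
        have : n = 0 := by omega
        subst m n; norm_num [ff]
      · obtain ⟨n, rfl⟩ := Int.eq_ofNat_of_zero_le h2
        have : m = -(n : ℤ) := by omega
        rw [this, zpow_neg_one]
        have : n ≠ 0 := by omega
        simp [ff, this]
      · obtain ⟨m, rfl⟩ := Int.eq_ofNat_of_zero_le h3
        have : m ≠ 0 := by omega
        simp [ff, this]
      · omega
      · simp
    | zero => simp
    | add x y _ _ hx hy => rw [map_add, hx, hy, add_zero]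
    | smul a x _ hx => rw [cc_smul, hx, mul_zero]
  · intro p hp i
    induction hp using Submodule.span_induction with
    | mem x hx =>
      obtain ⟨⟨m, n⟩, rfl⟩ := hx
      have e : pderiv i (G m (G n 1) + G n (G m 1) - C (bb m n)) =
        (G (m - (2 * i + 1 : ℕ)) (G n 1) + G n (G (m - (2 * i + 1 : ℕ)) 1) -
          C (bb (m - (2 * i + 1 : ℕ)) n)) +
        (G m (G (n - (2 * i + 1 : ℕ)) 1) + G (n - (2 * i + 1 : ℕ)) (G m 1) -
          C (bb m (n - (2 * i + 1 : ℕ)))) := by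
        have hb : bb (m - (2 * i + 1 : ℕ)) n = - bb m (n - (2 * i + 1 : ℕ)) := by
          unfold bb
          have : m - (2 * i + 1 : ℕ) + n = m + (n - (2 * i + 1 : ℕ)) := by ring
          rw [this]
          have h2 := zpow_odd (m - (2 * i + 1 : ℕ)) i
          rw [sub_add_cancel] at h2
          rw [h2]
          split_ifs <;> ring
        rw [hb, map_sub, map_add, pderiv_C]
        simp only [pderiv_G, pderiv_one, map_zero, zero_add, map_neg]
        ring
      rw [e]
      exact Submodule.add_mem _ (Submodule.subset_span ⟨(_, _), rfl⟩)
        (Submodule.subset_span ⟨(_, _), rfl⟩)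
    | zero => simp
    | add x y _ _ hx hy => rw [map_add]; exact Submodule.add_mem _ hx hy
    | smul a x _ hx => rw [Derivation.map_smul]; exact Submodule.smul_mem _ _ hx

lemma anti (m n : ℤ) (p : BRing) : G m (G n p) + G n (G m p) = bb m n • p := by
  induction p using op_induction generalizing m n with
  | h1 =>
    rw [smul_eq_C_mul, mul_one]
    exact sub_eq_zero.1 (anti_one m n)
  | hs c p h => simp only [map_smul]; rw [← smul_add, h, smul_comm]
  | ha p q hp hq => simp only [map_add, smul_add]; rw [← hp, ← hq]; abel
  | hX i p h =>
    simp only [G_X_mul, map_sub, map_smul]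
    have h1 := h m n
    have h2 := h (m + (2 * i + 1 : ℕ)) n
    have h3 := h m (n + (2 * i + 1 : ℕ))
    have hb : bb (m + (2 * i + 1 : ℕ)) n = - bb m (n + (2 * i + 1 : ℕ)) := by
      unfold bb
      have : m + (2 * i + 1 : ℕ) + n = m + (n + (2 * i + 1 : ℕ)) := by ring
      rw [this, zpow_odd]
      split_ifs <;> ring
    rw [hb] at h2
    simp only [smul_eq_C_mul, map_neg] at *
    linear_combination (X i) * h1 - C (cc i) * h2 - C (cc i) * h3

/-- The operators `∑ a_m G_m`. -/
def v : (ℤ →₀ ℂ) →ₗ[ℂ] Module.End ℂ BRing := Finsupp.linearCombination ℂ G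

lemma v_single (m : ℤ) (c : ℂ) : v (Finsupp.single m c) = c • G m := by
  simp [v, Finsupp.linearCombination_single]

lemma v_apply (a : ℤ →₀ ℂ) (p : BRing) (s : Finset ℤ) (hs : a.support ⊆ s) :
    v a p = ∑ m ∈ s, a m • G m p := by
  rw [v, Finsupp.linearCombination_apply, Finsupp.sum_of_support_subset _ hs _ (by simp)]
  simp

/-- The lowering map. -/
def low (i : ℕ) : (ℤ →₀ ℂ) →ₗ[ℂ] (ℤ →₀ ℂ) :=
  Finsupp.lmapDomain ℂ ℂ (fun m => m - (2 * i + 1 : ℕ))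

lemma pderiv_v (i : ℕ) (a : ℤ →₀ ℂ) (p : BRing) :
    pderiv i (v a p) = v a (pderiv i p) + v (low i a) p := by
  induction a using Finsupp.induction_linear with
  | zero => simp
  | add a b ha hb => simp only [map_add, LinearMap.add_apply, ha, hb]; ring
  | single m c =>
    rw [low, Finsupp.lmapDomain_apply, Finsupp.mapDomain_single, v_single, v_single]
    simp only [LinearMap.smul_apply, Derivation.map_smul, pderiv_G, smul_add]

lemma anti_v (m : ℤ) (a : ℤ →₀ ℂ) (p : BRing) :
    G m (v a p) + v a (G m p) = (2 * (-1 : ℂ) ^ m * a (-m)) • p := by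
  induction a using Finsupp.induction_linear with
  | zero => simp
  | add a b ha hb =>
    simp only [map_add, LinearMap.add_apply, Finsupp.add_apply, mul_add, add_smul]
    rw [← ha, ← hb]; abel
  | single n c =>
    rw [v_single]
    simp only [LinearMap.smul_apply, map_smul]
    rw [← smul_add, anti, smul_smul, bb, Finsupp.single_apply]
    congr 1
    by_cases h : m + n = 0
    · rw [if_pos h, if_pos (by omega)]; ring
    · rw [if_neg h, if_neg (by omega)]; ring
end

section
/-! ### Wick's theorem -/

/-- `v(a_0) v(a_1) ⋯ v(a_{r-1}) q`. -/
def W : (r : ℕ) → (Fin r → (ℤ →₀ ℂ)) → BRing → BRing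
  | 0, _, q => q
  | r + 1, a, q => v (a 0) (W r (Fin.tail a) q)

lemma W_succ (r : ℕ) (a : Fin (r + 1) → (ℤ →₀ ℂ)) (q : BRing) :
    W (r + 1) a q = v (a 0) (W r (Fin.tail a) q) := rfl

lemma W_neg (r : ℕ) (a : Fin r → (ℤ →₀ ℂ)) (q : BRing) : W r a (-q) = - W r a q := by
  induction r with
  | zero => rfl
  | succ r ih => rw [W_succ, W_succ, ih, map_neg]

lemma W_zero (r : ℕ) (a : Fin r → (ℤ →₀ ℂ)) : W r a 0 = 0 := by
  induction r with
  | zero => rfl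
  | succ r ih => rw [W_succ, ih, map_zero]

lemma W_removeNth_succ (r : ℕ) (a : Fin (r + 2) → (ℤ →₀ ℂ)) (q : BRing) (k : Fin (r + 1)) :
    W (r + 1) (k.succ.removeNth a) q = v (a 0) (W r (k.removeNth (Fin.tail a)) q) := by
  rw [W_succ]
  have h : Fin.tail (k.succ.removeNth a) = k.removeNth (Fin.tail a) := by
    funext l
    simp [Fin.tail, Fin.removeNth_apply]
  rw [h, Fin.removeNth_apply, Fin.succ_succAbove_zero]

lemma G_W (m : ℤ) (r : ℕ) (a : Fin (r + 1) → (ℤ →₀ ℂ)) (q : BRing) :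
    G m (W (r + 1) a q) =
      ∑ j : Fin (r + 1), ((-1 : ℂ) ^ (j : ℕ) * (2 * (-1 : ℂ) ^ m * a j (-m))) •
        W r (j.removeNth a) q + (-1 : ℂ) ^ (r + 1) • W (r + 1) a (G m q) := by
  induction r with
  | zero =>
    have h := anti_v m (a 0) q
    simp only [W, Fin.sum_univ_succ, Finset.univ_eq_empty, Finset.sum_empty]
    simp only [Fin.val_zero, pow_zero, one_mul, add_zero, zero_add, pow_one, neg_smul, one_smul]
    rw [← h]; abel
  | succ r ih =>
    have h := anti_v m (a 0) (W (r + 1) (Fin.tail a) q)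
    rw [W_succ, eq_sub_of_add_eq h, ih, map_add, map_sum, W_succ _ _ (G m q)]
    conv_rhs => rw [Fin.sum_univ_succ, Fin.removeNth_zero]
    simp only [W_removeNth_succ, Fin.val_zero, pow_zero, one_mul, Fin.val_succ, map_smul]
    rw [sub_add_eq_sub_sub, sub_eq_add_neg, sub_eq_add_neg, pow_succ _ (r + 1), mul_neg_one,
      neg_smul, ← Finset.sum_neg_distrib]
    congr 2
    refine Finset.sum_congr rfl fun j _ => ?_
    rw [← neg_smul]
    congr 1
    rw [pow_succ]
    simp [Fin.tail]

lemma pderiv_W (i : ℕ) (r : ℕ) (a : Fin r → (ℤ →₀ ℂ)) :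
    pderiv i (W r a 1) = ∑ k, W r (Function.update a k (low i (a k))) 1 := by
  induction r with
  | zero => simp [W]
  | succ r ih =>
    rw [W_succ, pderiv_v, ih, Fin.sum_univ_succ, W_succ, Fin.tail_update_zero,
      Function.update_self, map_sum, add_comm]
    congr 1
    refine Finset.sum_congr rfl fun k _ => ?_
    rw [W_succ, Fin.tail_update_succ, Function.update_of_ne (Fin.succ_ne_zero k).symm]
    rfl

/-- The defect in Wick's formula. -/
def Del (r : ℕ) (a : ℤ →₀ ℂ) (b : Fin (r + 1) → (ℤ →₀ ℂ)) : BRing :=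
  v a (W (r + 1) b 1) -
    ∑ j : Fin (r + 1), (-1 : ℂ) ^ (j : ℕ) • (v a (v (b j) 1) * W r (j.removeNth b) 1)

lemma pderiv_Del (i r : ℕ) (a : ℤ →₀ ℂ) (b : Fin (r + 1) → (ℤ →₀ ℂ)) :
    pderiv i (Del r a b) = Del r (low i a) b +
      ∑ k, Del r a (Function.update b k (low i (b k))) := by
  unfold Del
  rw [map_sub, pderiv_v, pderiv_W, map_sum, map_sum, Finset.sum_sub_distrib, Finset.sum_comm]
  have key : ∀ j : Fin (r + 1),
      pderiv i ((-1 : ℂ) ^ (j : ℕ) • (v a (v (b j) 1) * W r (j.removeNth b) 1)) =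
      (-1 : ℂ) ^ (j : ℕ) • (v (low i a) (v (b j) 1) * W r (j.removeNth b) 1) +
      ∑ k, (-1 : ℂ) ^ (j : ℕ) • (v a (v (Function.update b k (low i (b k)) j) 1) *
        W r (j.removeNth (Function.update b k (low i (b k)))) 1) := by
    intro j
    rw [Fin.sum_univ_succAbove _ j, Function.update_self, Fin.removeNth_update,
      Derivation.map_smul, pderiv_mul, pderiv_v, pderiv_v, pderiv_one, map_zero, zero_add,
      pderiv_W]
    have : ∀ l : Fin r, (-1 : ℂ) ^ (j : ℕ) •
        (v a (v (Function.update b (j.succAbove l) (low i (b (j.succAbove l))) j) 1) *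
        W r (j.removeNth (Function.update b (j.succAbove l) (low i (b (j.succAbove l))))) 1) =
        (-1 : ℂ) ^ (j : ℕ) • (v a (v (b j) 1) *
          W r (Function.update (j.removeNth b) l (low i (j.removeNth b l))) 1) := by
      intro l
      rw [Fin.removeNth_update_succAbove, Function.update_of_ne (Fin.succAbove_ne j l).symm]
      rfl
    rw [Finset.sum_congr rfl fun l _ => this l, ← Finset.smul_sum, ← Finset.mul_sum]
    simp only [← smul_add]
    congr 1
    ring
  rw [Finset.sum_congr rfl fun j _ => key j, Finset.sum_add_distrib]
  abel

lemma cc_Del (r : ℕ) (hr : Even r) (a : ℤ →₀ ℂ) (b : Fin (r + 1) → (ℤ →₀ ℂ)) :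
    constantCoeff (Del r a b) = 0 := by
  induction a using Finsupp.induction_linear with
  | zero => simp [Del]
  | add a a' h h' =>
    have : Del r (a + a') b = Del r a b + Del r a' b := by
      simp only [Del, map_add, LinearMap.add_apply, add_mul, smul_add, Finset.sum_add_distrib]
      abel
    rw [this, map_add, h, h', add_zero]
  | single m c =>
    have : Del r (Finsupp.single m c) b = c • (G m (W (r + 1) b 1) -
        ∑ j : Fin (r + 1), (-1 : ℂ) ^ (j : ℕ) • (G m (v (b j) 1) * W r (j.removeNth b) 1)) := by
      simp only [Del, v_single, LinearMap.smul_apply, smul_sub, Finset.smul_sum]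
      congr 1
      refine Finset.sum_congr rfl fun j _ => ?_
      rw [smul_mul_assoc, smul_comm]
    rw [this, cc_smul]
    apply mul_eq_zero_of_right
    rcases lt_trichotomy m 0 with hm | hm | hm
    · have h0 : G m 1 = 0 := by rw [G_one, sTildeZ_neg hm]
      rw [G_W, h0, W_zero, smul_zero, add_zero, ← Finset.sum_sub_distrib, Finset.sum_eq_zero,
        map_zero]
      intro j _
      have := anti_v m (b j) 1
      rw [h0, map_zero, add_zero] at this
      rw [this, smul_mul_assoc, one_mul, smul_smul, sub_self]
    · subst hm
      have h1 : G 0 1 = 1 := by rw [G_one, sTildeZ_zero]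
      have h2 := congrArg constantCoeff (G_W 0 r b 1)
      rw [h1, cc_G_zero, map_add, hr.add_one.neg_one_pow, cc_smul] at h2
      have h3 : ∀ j, constantCoeff (v (b j) 1) = b j 0 := by
        intro j
        have h4 := congrArg constantCoeff (anti_v 0 (b j) 1)
        rw [h1, map_add, cc_G_zero, cc_smul] at h4
        simp only [map_one, zpow_zero, neg_zero] at h4
        linear_combination h4 / 2
      rw [map_sub, cc_G_zero, map_sum]
      simp only [cc_smul, map_mul, cc_G_zero, h3, map_sum] at h2 ⊢
      have h5 : ∑ j : Fin (r + 1), (-1 : ℂ) ^ (j : ℕ) * (2 * (-1) ^ (0 : ℤ) * b j (-0)) *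
          constantCoeff (W r (j.removeNth b) 1) = 2 * ∑ j : Fin (r + 1), (-1 : ℂ) ^ (j : ℕ) *
          (b j 0 * constantCoeff (W r (j.removeNth b) 1)) := by
        rw [Finset.mul_sum]
        refine Finset.sum_congr rfl fun j _ => ?_
        simp only [zpow_zero, neg_zero]
        ring
      rw [h5] at h2
      linear_combination h2 / 2
    · rw [map_sub, cc_G_pos m hm, map_sum, Finset.sum_eq_zero, sub_zero]
      intro j _
      rw [cc_smul, map_mul, cc_G_pos m hm]; ring

lemma Del_zero (r : ℕ) (hr : Even r) (a : ℤ →₀ ℂ) (b : Fin (r + 1) → (ℤ →₀ ℂ)) :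
    Del r a b = 0 := by
  refine vanish_of_closed (Submodule.span ℂ
    (Set.range fun q : (ℤ →₀ ℂ) × (Fin (r + 1) → (ℤ →₀ ℂ)) => Del r q.1 q.2)) ?_ ?_ _
    (Submodule.subset_span ⟨(a, b), rfl⟩)
  · intro p hp
    induction hp using Submodule.span_induction with
    | mem x hx =>
      obtain ⟨⟨m, n⟩, rfl⟩ := hx
      exact cc_Del r hr _ _
    | zero => simp
    | add x y _ _ hx hy => rw [map_add, hx, hy, add_zero]
    | smul a x _ hx => rw [cc_smul, hx, mul_zero]
  · intro p hp i
    induction hp using Submodule.span_induction with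
    | mem x hx =>
      obtain ⟨⟨m, n⟩, rfl⟩ := hx
      rw [pderiv_Del]
      exact Submodule.add_mem _ (Submodule.subset_span ⟨(_, _), rfl⟩)
        (Submodule.sum_mem _ fun k _ => Submodule.subset_span ⟨(_, _), rfl⟩)
    | zero => simp
    | add x y _ _ hx hy => rw [map_add]; exact Submodule.add_mem _ hx hy
    | smul a x _ hx => rw [Derivation.map_smul]; exact Submodule.smul_mem _ _ hx

lemma wick (r : ℕ) (hr : Even r) (a : Fin (r + 2) → (ℤ →₀ ℂ)) :
    W (r + 2) a 1 = ∑ j : Fin (r + 1), (-1 : ℂ) ^ (j : ℕ) •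
      (v (a 0) (v (a j.succ) 1) * W r (fun k => a (j.succAbove k).succ) 1) :=
  sub_eq_zero.1 (Del_zero r hr (a 0) (Fin.tail a))

/-! ### The bilinear identity -/
open TensorProduct

/-- The bilinear identity in the tensor product. -/
def TBKP (τ : BRing) : Prop :=
  ∃ N0 : ℕ, ∀ N : ℕ, N0 ≤ N → ∑ m ∈ Finset.Icc (-(N : ℤ)) N,
    (-1 : ℂ) ^ m • (G m τ ⊗ₜ[ℂ] G (-m) τ) = τ ⊗ₜ[ℂ] τ

lemma TBKP_one : TBKP 1 := by
  refine ⟨0, fun N _ => ?_⟩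
  rw [Finset.sum_eq_single 0]
  · simp [G_one, sTildeZ_zero]
  · intro m _ hm
    rw [G_one, G_one]
    rcases lt_or_gt_of_ne hm with h | h
    · rw [sTildeZ_neg h, zero_tmul, smul_zero]
    · rw [sTildeZ_neg (m := -m) (by omega), tmul_zero, smul_zero]
  · intro h; simp at h

lemma Icc_reflect {M : Type*} [AddCommMonoid M] (N : ℕ) (f : ℤ → M) :
    ∑ m ∈ Finset.Icc (-(N : ℤ)) N, f (-m) = ∑ m ∈ Finset.Icc (-(N : ℤ)) N, f m := by
  refine Finset.sum_nbij' (fun m => -m) (fun m => -m) ?_ ?_ ?_ ?_ ?_ <;>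
    simp <;> omega

lemma TBKP_step (a : ℤ →₀ ℂ) (τ : BRing) (h : TBKP τ) : TBKP (v a τ) := by
  obtain ⟨N0, h⟩ := h
  obtain ⟨N1, hN1⟩ : ∃ N1 : ℕ, ∀ m ∈ a.support, m.natAbs ≤ N1 :=
    ⟨a.support.sup Int.natAbs, fun m hm => Finset.le_sup (f := Int.natAbs) hm⟩
  refine ⟨max N0 N1, fun N hN => ?_⟩
  have hN0 := h N (le_trans (le_max_left _ _) hN)
  have hs : a.support ⊆ Finset.Icc (-(N : ℤ)) N := by
    intro m hm
    have := hN1 m hm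
    have := le_trans (le_max_right _ _) hN
    rw [Finset.mem_Icc]; omega
  have e1 : ∀ m, G m (v a τ) = (2 * (-1 : ℂ) ^ m * a (-m)) • τ - v a (G m τ) := fun m =>
    eq_sub_of_add_eq (anti_v m a τ)
  have hv : ∀ p, v a p = ∑ m ∈ Finset.Icc (-(N : ℤ)) N, a m • G m p := fun p => v_apply a p _ hs
  set z : ℂ := ∑ m ∈ Finset.Icc (-(N : ℤ)) N, (-1 : ℂ) ^ m * a m * a (-m) with hz
  have h1 : ∑ m ∈ Finset.Icc (-(N : ℤ)) N, a m • v a (G m τ) = v a (v a τ) := by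
    conv_rhs => rw [hv τ, map_sum]
    simp only [map_smul]
  have hvv : v a (v a τ) = z • τ := by
    have h2 : v a (v a τ) + v a (v a τ) = (2 * z) • τ := by
      rw [hz, Finset.mul_sum, Finset.sum_smul]
      nth_rewrite 2 [← h1]
      rw [hv (v a τ), ← Finset.sum_add_distrib]
      refine Finset.sum_congr rfl fun m _ => ?_
      rw [← smul_add, anti_v, smul_smul]
      congr 1; ring
    rw [← two_smul ℂ, mul_smul] at h2
    have := congrArg (fun x => (2 : ℂ)⁻¹ • x) h2
    simpa [smul_smul] using this
  have h3 := h1.trans hvv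
  have h4 := (Icc_reflect N (fun m => a m • v a (G m τ))).trans h3
  have key : ∀ m, (-1 : ℂ) ^ m • (G m (v a τ) ⊗ₜ[ℂ] G (-m) (v a τ)) =
      TensorProduct.map (v a) (v a) ((-1 : ℂ) ^ m • (G m τ ⊗ₜ[ℂ] G (-m) τ)) +
      (4 * ((-1 : ℂ) ^ m * a m * a (-m))) • (τ ⊗ₜ[ℂ] τ)
      - (2 : ℂ) • ((a m • v a (G m τ)) ⊗ₜ[ℂ] τ) - (2 : ℂ) • (τ ⊗ₜ[ℂ] (a (-m) • v a (G (-m) τ))) := by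
    intro m
    rw [e1, e1, map_smul, TensorProduct.map_tmul, zpow_neg_one, neg_neg]
    simp only [sub_tmul, tmul_sub, smul_tmul', tmul_smul, smul_sub, smul_smul]
    have q1 := zpow_sq m
    have q2 : (-1 : ℂ) ^ m * (2 * (-1) ^ m * a m * (2 * (-1) ^ m * a (-m))) =
      4 * ((-1) ^ m * a m * a (-m)) := by linear_combination (4 * (-1) ^ m * a m * a (-m)) * q1
    have q3 : (-1 : ℂ) ^ m * (2 * (-1) ^ m * a m) = 2 * a m := by
      linear_combination (2 * a m) * q1
    have q4 : (-1 : ℂ) ^ m * (2 * (-1) ^ m * a (-m)) = 2 * a (-m) := by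
      linear_combination (2 * a (-m)) * q1
    rw [q2, q3, q4]; abel
  rw [Finset.sum_congr rfl fun m _ => key m, Finset.sum_sub_distrib, Finset.sum_sub_distrib,
    Finset.sum_add_distrib, ← map_sum, hN0, ← Finset.sum_smul, ← Finset.mul_sum, ← hz,
    ← Finset.smul_sum, ← Finset.smul_sum, ← sum_tmul, ← tmul_sum, h3, h4, map_tmul,
    tmul_smul, ← smul_tmul', mul_smul, smul_smul, smul_smul]
  module

lemma TBKP_W (r : ℕ) (a : Fin r → (ℤ →₀ ℂ)) : TBKP (W r a 1) := by
  induction r with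
  | zero => exact TBKP_one
  | succ r ih => exact TBKP_step _ _ (ih _)

lemma BKP_of_TBKP (τ : BRing) (h : TBKP τ) : SatisfiesBKP τ := by
  obtain ⟨N0, h⟩ := h
  obtain ⟨M, hM⟩ := G_vanish τ
  have hN := h (max N0 M.natAbs) (le_max_left _ _)
  have hMN : M.natAbs ≤ max N0 M.natAbs := le_max_right _ _
  set N := max N0 M.natAbs
  unfold SatisfiesBKP
  let Φ : BRing ⊗[ℂ] BRing →ₗ[ℂ] BRing2 := TensorProduct.lift
    ((LinearMap.mul ℂ BRing2).compl₁₂ (MvPolynomial.rename Sum.inl).toLinearMap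
      (MvPolynomial.rename Sum.inr).toLinearMap)
  have hΦ : ∀ p q, Φ (p ⊗ₜ q) = inL p * inR q := fun p q => rfl
  have hR : ∀ (c : ℂ) p, inR (c • p) = c • inR p := fun c p =>
    map_smul (MvPolynomial.rename Sum.inr) c p
  rw [finsum_eq_sum_of_support_subset (s := Finset.Icc (-(N : ℤ)) N)]
  · rw [← hΦ τ τ, ← hN, map_sum]
    refine Finset.sum_congr rfl fun m _ => ?_
    rw [map_smul, hΦ, leftCoeff_eq, rightCoeff_eq', Gr_eq, hR, zpow_neg_one, mul_smul_comm]
  · intro m hm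
    rw [Function.mem_support] at hm
    by_contra hcon
    apply hm
    simp only [Finset.coe_Icc, Set.mem_Icc, not_and_or, not_le] at hcon
    rw [leftCoeff_eq, rightCoeff_eq', Gr_eq]
    rcases hcon with h | h
    · rw [hM m (by omega), map_zero, zero_mul]
    · rw [hM (-m) (by omega), smul_zero, map_zero, mul_zero]
end

section
/-! ### Expansion of the Pfaffian -/

/-- Condition on permutations, with natural number indices. -/
def pcond (n : ℕ) (σ : Equiv.Perm (Fin (2 * n))) : Prop :=
  (∀ i (h : i < n), σ ⟨2 * i, by omega⟩ < σ ⟨2 * i + 1, by omega⟩) ∧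
  (∀ i j (_ : i < j) (h : j < n), σ ⟨2 * i, by omega⟩ < σ ⟨2 * j, by omega⟩)

lemma pcond_iff (n : ℕ) (σ : Equiv.Perm (Fin (2 * n))) : pfaffianCond σ ↔ pcond n σ := by
  have e : 2 * n / 2 = n := by omega
  constructor
  · rintro ⟨h1, h2⟩
    exact ⟨fun i h => h1 ⟨i, by omega⟩, fun i j hij h => h2 ⟨i, by omega⟩ ⟨j, by omega⟩ hij⟩
  · rintro ⟨h1, h2⟩
    exact ⟨fun i => h1 i (by omega), fun i j hij => h2 i j hij (by omega)⟩

variable {R : Type*} [CommRing R]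

/-- The product attached to a permutation. -/
def pprod (n : ℕ) (A : Matrix (Fin (2 * n)) (Fin (2 * n)) R) (σ : Equiv.Perm (Fin (2 * n))) : R :=
  ∏ i : Fin n, A (σ ⟨2 * i, by omega⟩) (σ ⟨2 * i + 1, by omega⟩)

open scoped Classical in
/-- The summand of the Pfaffian. -/
def pterm (n : ℕ) (A : Matrix (Fin (2 * n)) (Fin (2 * n)) R) (σ : Equiv.Perm (Fin (2 * n))) : R :=
  if pcond n σ then (Equiv.Perm.sign σ : ℤ) • pprod n A σ else 0

lemma pfaffian_eq (n : ℕ) (A : Matrix (Fin (2 * n)) (Fin (2 * n)) R) :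
    pfaffian A = ∑ σ, pterm n A σ := by
  unfold pfaffian pterm
  refine Finset.sum_congr rfl fun σ _ => ?_
  have e : 2 * n / 2 = n := by omega
  have hp : (∏ i : Fin (2 * n / 2),
          A (σ ⟨2 * i.val, by have := i.isLt; omega⟩)
            (σ ⟨2 * i.val + 1, by have := i.isLt; omega⟩)) = pprod n A σ := by
    unfold pprod
    exact Fintype.prod_equiv (finCongr e) _ _ fun i => rfl
  rw [hp]
  by_cases h : pcond n σ
  · rw [if_pos h, if_pos ((pcond_iff n σ).2 h)]
  · rw [if_neg h, if_neg (fun h' => h ((pcond_iff n σ).1 h'))]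

/-- Insertion of the pair `(0, j+1)` into a permutation. -/
def ins (n : ℕ) (j : Fin (2 * n + 1)) (σ : Equiv.Perm (Fin (2 * n))) :
    Equiv.Perm (Fin (2 * n + 1 + 1)) :=
  Equiv.Perm.decomposeFin.symm (0, j.cycleRange.symm * Equiv.Perm.decomposeFin.symm (0, σ))

lemma ins_zero (n : ℕ) (j : Fin (2 * n + 1)) (σ : Equiv.Perm (Fin (2 * n))) :
    ins n j σ 0 = 0 := by
  simp [ins]

lemma ins_one (n : ℕ) (j : Fin (2 * n + 1)) (σ : Equiv.Perm (Fin (2 * n))) :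
    ins n j σ (Fin.succ 0) = j.succ := by
  unfold ins
  rw [Equiv.Perm.decomposeFin_symm_apply_succ]
  simp [Fin.cycleRange_symm_zero]

lemma ins_succ_succ (n : ℕ) (j : Fin (2 * n + 1)) (σ : Equiv.Perm (Fin (2 * n))) (k : Fin (2 * n)) :
    ins n j σ k.succ.succ = (j.succAbove (σ k)).succ := by
  unfold ins
  rw [Equiv.Perm.decomposeFin_symm_apply_succ, Equiv.Perm.mul_apply,
    Equiv.Perm.decomposeFin_symm_apply_succ]
  simp [Fin.cycleRange_symm_succ]

lemma ins_sign (n : ℕ) (j : Fin (2 * n + 1)) (σ : Equiv.Perm (Fin (2 * n))) :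
    Equiv.Perm.sign (ins n j σ) = (-1) ^ (j : ℕ) * Equiv.Perm.sign σ := by
  unfold ins
  rw [Equiv.Perm.decomposeFin.symm_sign, Equiv.Perm.sign_mul, Equiv.Perm.decomposeFin.symm_sign]
  simp [Fin.sign_cycleRange, Equiv.Perm.sign_symm]

lemma exists_decomp {m : ℕ} (σ : Equiv.Perm (Fin (m + 1))) (h : σ 0 = 0) :
    ∃ ρ, σ = Equiv.Perm.decomposeFin.symm (0, ρ) := by
  obtain ⟨⟨p, ρ⟩, rfl⟩ := Equiv.Perm.decomposeFin.symm.surjective σ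
  rw [Equiv.Perm.decomposeFin_symm_apply_zero] at h
  exact ⟨ρ, by rw [h]⟩

lemma ins_pcond (n : ℕ) (j : Fin (2 * n + 1)) (σ : Equiv.Perm (Fin (2 * n))) :
    pcond (n + 1) (ins n j σ) ↔ pcond n σ := by
  have hm : ∀ a b, (j.succAbove (σ a)).succ < (j.succAbove (σ b)).succ ↔ σ a < σ b := by
    intro a b
    rw [Fin.succ_lt_succ_iff, Fin.succAbove_lt_succAbove_iff]
  have he : ∀ i (h : i < n), ins n j σ ⟨2 * (i + 1), by omega⟩ =
      (j.succAbove (σ ⟨2 * i, by omega⟩)).succ := fun i h => by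
    rw [← ins_succ_succ]; rfl
  have ho : ∀ i (h : i < n), ins n j σ ⟨2 * (i + 1) + 1, by omega⟩ =
      (j.succAbove (σ ⟨2 * i + 1, by omega⟩)).succ := fun i h => by
    rw [← ins_succ_succ]; rfl
  have h0 : ins n j σ ⟨2 * 0, by omega⟩ = 0 := ins_zero n j σ
  have h1 : ins n j σ ⟨2 * 0 + 1, by omega⟩ = j.succ := ins_one n j σ
  constructor
  · rintro ⟨a, b⟩
    refine ⟨fun i h => ?_, fun i k hik h => ?_⟩
    · have := a (i + 1) (by omega)
      rw [← hm, ← he i h, ← ho i h]; exact this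
    · have := b (i + 1) (k + 1) (by omega) (by omega)
      rw [← hm, ← he i (by omega), ← he k h]; exact this
  · rintro ⟨a, b⟩
    refine ⟨fun i h => ?_, fun i k hik h => ?_⟩
    · rcases i with _ | i
      · exact lt_of_eq_of_lt h0 (lt_of_lt_of_eq (Fin.succ_pos j) h1.symm)
      · exact lt_of_eq_of_lt (he i (by omega)) (lt_of_lt_of_eq ((hm _ _).2 (a i (by omega)))
          (ho i (by omega)).symm)
    · rcases k with _ | k
      · omega
      rcases i with _ | i
      · exact lt_of_eq_of_lt h0 (lt_of_lt_of_eq (Fin.succ_pos _) (he k (by omega)).symm)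
      · exact lt_of_eq_of_lt (he i (by omega)) (lt_of_lt_of_eq
          ((hm _ _).2 (b i k (by omega) (by omega))) (he k (by omega)).symm)

lemma ins_pprod (n : ℕ) (A : Matrix (Fin (2 * n + 1 + 1)) (Fin (2 * n + 1 + 1)) R)
    (j : Fin (2 * n + 1)) (σ : Equiv.Perm (Fin (2 * n))) :
    pprod (n + 1) A (ins n j σ) = A 0 j.succ *
      pprod n (fun k l => A (j.succAbove k).succ (j.succAbove l).succ) σ := by
  unfold pprod
  rw [Fin.prod_univ_succ]
  congr 1
  · exact congrArg₂ A (ins_zero n j σ) (ins_one n j σ)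
  · refine Finset.prod_congr rfl fun i _ => ?_
    exact congrArg₂ A (ins_succ_succ n j σ ⟨2 * i, by omega⟩)
      (ins_succ_succ n j σ ⟨2 * i + 1, by omega⟩)

lemma ins_pterm (n : ℕ) (A : Matrix (Fin (2 * n + 1 + 1)) (Fin (2 * n + 1 + 1)) R)
    (j : Fin (2 * n + 1)) (σ : Equiv.Perm (Fin (2 * n))) :
    pterm (n + 1) A (ins n j σ) = (-1) ^ (j : ℕ) * A 0 j.succ *
      pterm n (fun k l => A (j.succAbove k).succ (j.succAbove l).succ) σ := by
  unfold pterm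
  have e := ins_sign n j σ
  by_cases hc : pcond n σ
  · rw [if_pos hc, if_pos ((ins_pcond n j σ).2 hc), ins_pprod]
    have : (Equiv.Perm.sign (ins n j σ) : ℤ) = (-1) ^ (j : ℕ) * (Equiv.Perm.sign σ : ℤ) := by
      rw [e]; simp
    have h2 : ((Equiv.Perm.sign (α := Fin (2 * (n + 1))) (ins n j σ) : ℤˣ) : ℤ) =
      (-1) ^ (j : ℕ) * (Equiv.Perm.sign σ : ℤ) := this
    rw [h2]
    simp only [zsmul_eq_mul]
    push_cast
    ring
  · rw [if_neg hc, if_neg (fun h' => hc ((ins_pcond n j σ).1 h')), mul_zero]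

lemma ins_inj (n : ℕ) {j j' : Fin (2 * n + 1)} {σ σ' : Equiv.Perm (Fin (2 * n))}
    (h : ins n j σ = ins n j' σ') : j = j' ∧ σ = σ' := by
  have h1 : j = j' := by
    have := ins_one n j σ
    rw [h, ins_one] at this
    exact (Fin.succ_injective _ this).symm
  subst h1
  refine ⟨rfl, ?_⟩
  unfold ins at h
  have h2 := Equiv.Perm.decomposeFin.symm.injective h
  have h3 := mul_left_cancel (Prod.ext_iff.1 h2).2
  have h4 := Equiv.Perm.decomposeFin.symm.injective h3
  exact (Prod.ext_iff.1 h4).2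

lemma ins_surj (n : ℕ) (σ : Equiv.Perm (Fin (2 * n + 1 + 1))) (h : pcond (n + 1) σ) :
    ∃ j ρ, ins n j ρ = σ := by
  have h0 : σ 0 = 0 := by
    obtain ⟨x, hx⟩ := σ.surjective 0
    obtain ⟨i, hi | hi⟩ : ∃ i, x.val = 2 * i ∨ x.val = 2 * i + 1 := ⟨x.val / 2, by omega⟩
    · have ex : x = ⟨2 * i, by omega⟩ := Fin.ext hi
      rcases Nat.eq_zero_or_pos i with h1 | h1
      · subst h1
        have ex' : x = 0 := ex
        rw [← ex', hx, ex']
      · have h2 : σ ⟨2 * 0, by omega⟩ < σ ⟨2 * i, by omega⟩ := h.2 0 i h1 (by omega)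
        rw [← ex, hx] at h2
        exact absurd h2 (Fin.not_lt_zero _)
    · have ex : x = ⟨2 * i + 1, by omega⟩ := Fin.ext hi
      have h2 : σ ⟨2 * i, by omega⟩ < σ ⟨2 * i + 1, by omega⟩ := h.1 i (by omega)
      rw [← ex, hx] at h2
      exact absurd h2 (Fin.not_lt_zero _)
  obtain ⟨ρ, rfl⟩ := exists_decomp σ h0
  obtain ⟨ρ', h'⟩ := exists_decomp ((ρ 0).cycleRange * ρ) (by
    rw [Equiv.Perm.mul_apply, Fin.cycleRange_self])
  refine ⟨ρ 0, ρ', ?_⟩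
  unfold ins
  rw [← h']
  congr 2
  ext x
  simp

lemma pfaffian_expand (n : ℕ) (A : Matrix (Fin (2 * n + 1 + 1)) (Fin (2 * n + 1 + 1)) R) :
    pfaffian (m := 2 * (n + 1)) A = ∑ j : Fin (2 * n + 1), (-1) ^ (j : ℕ) * A 0 j.succ *
      pfaffian (m := 2 * n) (fun k l => A (j.succAbove k).succ (j.succAbove l).succ) := by
  refine Eq.trans (pfaffian_eq (n + 1) A) ?_
  refine Eq.trans ?_ (Finset.sum_congr rfl fun j _ =>
    ((congrArg _ (pfaffian_eq n _)).trans (Finset.mul_sum _ _ _)).symm)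
  rw [← Finset.sum_product']
  symm
  refine Finset.sum_of_injOn (fun x => ins n x.1 x.2) ?_ ?_ ?_ ?_
  · rintro ⟨j, σ⟩ _ ⟨j', σ'⟩ _ h
    obtain ⟨h1, h2⟩ := ins_inj n h
    exact Prod.ext h1 h2
  · intro x _
    exact Finset.mem_coe.2 (Finset.mem_univ _)
  · intro σ _ hσ
    by_contra hne
    have hc : pcond (n + 1) σ := by
      by_contra hc
      exact hne (if_neg hc)
    obtain ⟨j, ρ, h⟩ := ins_surj n σ hc
    exact hσ ⟨(j, ρ), by simp, h⟩
  · intro x _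
    exact (ins_pterm n A x.1 x.2).symm

lemma pfaffian_zero (A : Matrix (Fin (2 * 0)) (Fin (2 * 0)) R) : pfaffian A = 1 := by
  have : Subsingleton (Equiv.Perm (Fin (2 * 0))) :=
    inferInstanceAs (Subsingleton (Equiv.Perm (Fin 0)))
  rw [pfaffian_eq]
  rw [Fintype.sum_eq_single 1 (fun σ h => (h (Subsingleton.elim _ _)).elim)]
  unfold pterm pprod pcond
  rw [if_pos ⟨fun i h => by omega, fun i j _ h => by omega⟩]
  simp

lemma pfaffian_W (n : ℕ) (M : Matrix (Fin (2 * n)) (Fin (2 * n)) BRing)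
    (a : Fin (2 * n) → (ℤ →₀ ℂ)) (h : ∀ i j, i < j → M i j = v (a i) (v (a j) 1)) :
    pfaffian M = W (2 * n) a 1 := by
  induction n with
  | zero => rw [pfaffian_zero]; rfl
  | succ n ih =>
    refine (pfaffian_expand n M).trans (Eq.trans ?_ (wick (2 * n) (by simp) a).symm)
    refine Finset.sum_congr rfl fun j _ => ?_
    rw [ih (fun k l => M (j.succAbove k).succ (j.succAbove l).succ)
      (fun k => a (j.succAbove k).succ) (fun k l hkl => h _ _ (by
        have := Fin.succ_lt_succ_iff.2 ((Fin.succAbove_lt_succAbove_iff (p := j)).2 hkl)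
        exact this))]
    have h2 : M 0 j.succ = v (a 0) (v (a j.succ) 1) := h 0 j.succ (Fin.succ_pos j)
    rw [h2, mul_assoc]
    rcases neg_one_pow_eq_or ℂ (j : ℕ) with e | e
    · have e' : ((-1 : BRing)) ^ (j : ℕ) = 1 := by
        have := congrArg (C (σ := ℕ)) e
        simpa using this
      rw [e, e', one_smul, one_mul]
    · have e' : ((-1 : BRing)) ^ (j : ℕ) = -1 := by
        have := congrArg (C (σ := ℕ)) e
        simpa using this
      rw [e, e', neg_smul, one_smul, neg_one_mul]
end

section
/-! ### The entries of the matrix -/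

lemma sB_shift (n K : ℕ) (h : n < K) (c : ℕ → ℂ) :
    sB n (tShift c) = ∑ k ∈ Finset.range K, sC k c • sTildeZ ((n : ℤ) - k) := by
  have h1 : sB n (tShift c) = sA (fun j => C (c j) + tTilde j) n := by
    have : tShift c = fun j => C (c j) + tTilde j := by
      funext j; unfold tShift; rw [add_comm]
    rw [this]; rfl
  have h2 : ∀ k, sA (fun j => (C (c j) : BRing)) k = C (sC k c) := by
    intro k
    have := sA_map (Algebra.ofId ℂ BRing) c k
    refine Eq.trans ?_ (this.symm.trans ?_)
    · rfl
    · rfl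
  rw [h1, sA_add]
  have hsub : Finset.range (n + 1) ⊆ Finset.range K := Finset.range_subset_range.2 h
  rw [← Finset.sum_subset hsub]
  · refine Finset.sum_congr rfl fun k hk => ?_
    have hk' : k ≤ n := Nat.lt_succ_iff.1 (Finset.mem_range.1 hk)
    rw [h2, ← Nat.cast_sub hk', sTildeZ_natCast, MvPolynomial.smul_eq_C_mul]
  · intro k _ hk
    rw [Finset.mem_range] at hk
    rw [sTildeZ_neg (by omega), smul_zero]

lemma chiB_eq (l μ : ℕ) (c c' : ℕ → BRing) :
    chiB l μ c c' = (2 : ℂ)⁻¹ • ∑ k ∈ Finset.range (μ + 1), ff k • (sB (l + k) c * sB (μ - k) c') := by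
  unfold chiB
  rw [Finset.sum_range_succ', smul_add, add_comm, Finset.smul_sum]
  congr 1
  · rw [Finset.range_eq_Ico, Finset.sum_Ico_add' (fun k => (2 : ℂ)⁻¹ • ff k • (sB (l + k) c * sB (μ - k) c')) 0 μ 1]
    refine Finset.sum_congr ?_ fun k hk => ?_
    · ext k; simp only [Finset.mem_Icc, Finset.mem_Ico]; omega
    · have : k ≠ 0 := by have := (Finset.mem_Icc.1 hk).1; omega
      rw [ff, if_neg this, smul_smul]
      congr 1
      ring
  · simp [ff]

/-- The vector attached to a part and a sequence. -/
def avec (r : ℂ) (K l : ℕ) (c : ℕ → ℂ) : ℤ →₀ ℂ :=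
  ∑ k ∈ Finset.range K, Finsupp.single ((l : ℤ) - k) (r * sC k c)

lemma v_avec (r : ℂ) (K l : ℕ) (c : ℕ → ℂ) (p : BRing) :
    v (avec r K l c) p = ∑ k ∈ Finset.range K, (r * sC k c) • G ((l : ℤ) - k) p := by
  unfold avec
  rw [map_sum, LinearMap.sum_apply]
  refine Finset.sum_congr rfl fun k _ => ?_
  rw [v_single, LinearMap.smul_apply]

lemma chiB_v (r : ℂ) (hr : r * r = (2 : ℂ)⁻¹) (K l μ : ℕ) (h : l + μ < K) (c c' : ℕ → ℂ) :
    chiB l μ (tShift c) (tShift c') = v (avec r K l c) (v (avec r K μ c') 1) := by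
  have hR : v (avec r K l c) (v (avec r K μ c') 1) =
      ∑ k ∈ Finset.range K, ∑ k' ∈ Finset.range K, ∑ i ∈ Finset.range (μ + 1),
        ((r * sC k c) * (r * sC k' c') * ff i) •
          (sTildeZ ((l : ℤ) - k + i) * sTildeZ ((μ : ℤ) - k' - i)) := by
    rw [v_avec]
    refine Finset.sum_congr rfl fun k _ => ?_
    rw [v_avec, map_sum, Finset.smul_sum]
    refine Finset.sum_congr rfl fun k' _ => ?_
    rw [map_smul, GG_one _ _ μ (by omega), smul_smul, Finset.smul_sum]
    refine Finset.sum_congr rfl fun i _ => ?_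
    rw [smul_smul]
  rw [hR, chiB_eq, Finset.smul_sum]
  rw [Finset.sum_congr rfl fun k _ => Finset.sum_comm, Finset.sum_comm]
  refine Finset.sum_congr rfl fun i hi => ?_
  have hi' : i ≤ μ := Nat.lt_succ_iff.1 (Finset.mem_range.1 hi)
  rw [sB_shift (l + i) K (by omega), sB_shift (μ - i) K (by omega), Finset.sum_mul_sum,
    Finset.smul_sum, Finset.smul_sum]
  refine Finset.sum_congr rfl fun k _ => ?_
  rw [Finset.smul_sum, Finset.smul_sum]
  refine Finset.sum_congr rfl fun k' _ => ?_
  rw [smul_mul_smul_comm, smul_smul, smul_smul, ← hr]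
  have e1 : ((l + i : ℕ) : ℤ) - k = (l : ℤ) - k + i := by push_cast; ring
  have e2 : ((μ - i : ℕ) : ℤ) - k' = (μ : ℤ) - k' - i := by rw [Nat.cast_sub hi']; ring
  rw [e1, e2]
  congr 1
  ring

lemma main (n : ℕ) (lam : Fin (2 * n) → ℕ) (c : Fin (2 * n) → ℕ → ℂ) :
    SatisfiesBKP (pfaffian (chiMatrix lam c)) := by
  obtain ⟨r, hr⟩ := IsAlgClosed.exists_pow_nat_eq ((2 : ℂ)⁻¹) (n := 2) (by norm_num)
  rw [pow_two] at hr
  have hle : ∀ i, lam i ≤ ∑ i, lam i := fun i =>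
    Finset.single_le_sum (fun _ _ => Nat.zero_le _) (Finset.mem_univ i)
  rw [pfaffian_W n (chiMatrix lam c) (fun i => avec r (2 * (∑ i, lam i) + 1) (lam i) (c i))]
  · exact BKP_of_TBKP _ (TBKP_W _ _)
  · intro i j hij
    have h1 := hle i
    have h2 := hle j
    rw [← chiB_v r hr _ _ _ (by omega)]
    unfold chiMatrix skewOf
    rw [Matrix.of_apply, if_pos hij]
end

end BKPproof
end

noncomputable section

/-- For every `n ≥ 0`, every extended strict partition
`λ_1 > λ_2 > ⋯ > λ_{2n} ≥ 0` of even length, and arbitrary sequences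
`c_1, …, c_{2n}` of complex numbers, the polynomial
`τ = Pf( χ_{λ_i,λ_j}(t̃+c_i, t̃+c_j) )_{1≤i,j≤2n}` satisfies the BKP bilinear identity. -/
theorem polynomial_tau_BKP (n : ℕ) (lam : Fin (2 * n) → ℕ) (hlam : StrictAnti lam)
    (c : Fin (2 * n) → ℕ → ℂ) :
    SatisfiesBKP (pfaffian (chiMatrix lam c)) := by
  exact BKPproof.main n lam c

end
end

section
/- Every nonzero polynomial τ ∈ ℂ[t_1,t_3,t_5,…] satisfying the BKP bilinear identity is of the form τ = a · Pf( χ_{λ_i,λ_j}(t̃ + c_i, t̃ + c_j) )_{1≤i,j≤2n} for some n ≥ 0, some integers λ_1 > λ_2 > ⋯ > λ_{2n} ≥ 0 (an extended strict partition of even length), some sequences c_1, …, c_{2n} of complex numbers, and some nonzero scalar a ∈ ℂ. -/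
noncomputable section
open MvPolynomial

/-! ### Schur generating series -/

/-- generating series of `s_n(c)` -/
def SS {R : Type*} [CommRing R] [Algebra ℂ R] (c : ℕ → R) : PowerSeries R :=
  PowerSeries.mk fun n => aeval c (schurPoly n)

/-- logarithmic derivative series -/
def DD {R : Type*} [CommRing R] [Algebra ℂ R] (c : ℕ → R) : PowerSeries R :=
  PowerSeries.mk fun j => ((j : R) + 1) * c (j + 1)

section
variable {R : Type*} [CommRing R] [Algebra ℂ R]

lemma natCast_cancel (n : ℕ) {x y : R} (h : x * ((n : R) + 1) = y * ((n : R) + 1)) : x = y := by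
  have hu : IsUnit ((n : R) + 1) := by
    have : ((n : R) + 1) = algebraMap ℂ R ((n : ℂ) + 1) := by simp
    rw [this]
    exact (IsUnit.mk0 _ (Nat.cast_add_one_ne_zero n)).map _
  exact hu.mul_right_cancel h

lemma schur_rec (c : ℕ → R) (n : ℕ) :
    aeval c (schurPoly (n + 1)) * ((n : R) + 1) =
      ∑ j ∈ Finset.range (n + 1), (((j : R) + 1) * c (j + 1)) * aeval c (schurPoly (n - j)) := by
  rw [schurPoly]
  rw [map_smul, map_sum, Algebra.smul_def, mul_comm, ← mul_assoc]
  have : ((n : R) + 1) * algebraMap ℂ R ((n : ℂ) + 1)⁻¹ = 1 := by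
    have : ((n : R) + 1) = algebraMap ℂ R ((n : ℂ) + 1) := by simp
    rw [this, ← map_mul, mul_inv_cancel₀ (Nat.cast_add_one_ne_zero n), map_one]
  rw [this, one_mul]
  refine Finset.sum_congr rfl fun j _ => ?_
  rw [map_smul, map_mul, aeval_X, Algebra.smul_def]
  simp [mul_assoc]

lemma SS_deriv (c : ℕ → R) : PowerSeries.derivative R (SS c) = DD c * SS c := by
  ext n
  rw [PowerSeries.coeff_derivative, PowerSeries.coeff_mul,
    Finset.Nat.sum_antidiagonal_eq_sum_range_succ_mk]
  simp only [SS, DD, PowerSeries.coeff_mk]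
  exact schur_rec c n

lemma SS_const (c : ℕ → R) : PowerSeries.coeff 0 (SS c) = 1 := by
  simp [SS, schurPoly]

lemma ode_unique (D F G : PowerSeries R) (h0 : PowerSeries.coeff 0 F = PowerSeries.coeff 0 G)
    (hF : PowerSeries.derivative R F = D * F) (hG : PowerSeries.derivative R G = D * G) :
    F = G := by
  ext n
  induction n using Nat.strong_induction_on with
  | _ n ih =>
    cases n with
    | zero => exact h0
    | succ n =>
      apply natCast_cancel n
      rw [← PowerSeries.coeff_derivative, ← PowerSeries.coeff_derivative, hF, hG,
        PowerSeries.coeff_mul, PowerSeries.coeff_mul]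
      refine Finset.sum_congr rfl fun p hp => ?_
      replace hp := Finset.HasAntidiagonal.mem_antidiagonal.1 hp
      rw [ih p.2 (by omega)]

lemma SS_unique (c : ℕ → R) (F : PowerSeries R) (h0 : PowerSeries.coeff 0 F = 1)
    (hF : PowerSeries.derivative R F = DD c * F) : F = SS c :=
  ode_unique (DD c) F (SS c) (by rw [h0, SS_const]) hF (SS_deriv c)

lemma SS_add (c c' : ℕ → R) : SS (c + c') = SS c * SS c' := by
  symm
  apply SS_unique
  · simp [PowerSeries.coeff_mul, SS_const]
  · rw [Derivation.leibniz, SS_deriv, SS_deriv]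
    have : DD (c + c') = DD c + DD c' := by
      ext n; simp [DD, mul_add]
    rw [this]
    simp only [smul_eq_mul]
    ring

lemma SS_zero : SS (0 : ℕ → R) = 1 := by
  symm
  apply SS_unique
  · simp
  · have : DD (0 : ℕ → R) = 0 := by ext n; simp [DD]
    rw [this]; simp

lemma SS_map {R' : Type*} [CommRing R'] [Algebra ℂ R'] (g : R →ₐ[ℂ] R') (c : ℕ → R) :
    PowerSeries.map (g : R →+* R') (SS c) = SS (fun j => g (c j)) := by
  ext n
  simp only [SS, PowerSeries.coeff_map, PowerSeries.coeff_mk]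
  have : (aeval fun j => g (c j)) = g.comp (aeval c) := by
    apply MvPolynomial.algHom_ext; intro i; simp
  rw [this]; rfl

lemma schur_scale (a : R) (c : ℕ → R) (n : ℕ) :
    aeval (fun j => a ^ j * c j) (schurPoly n) = a ^ n * aeval c (schurPoly n) := by
  induction n using Nat.strong_induction_on with
  | _ n ih =>
    cases n with
    | zero => simp [schurPoly]
    | succ n =>
      apply natCast_cancel n
      rw [schur_rec, mul_assoc, schur_rec, Finset.mul_sum]
      refine Finset.sum_congr rfl fun j hj => ?_
      rw [Finset.mem_range] at hj
      rw [ih (n - j) (by omega)]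
      have : a ^ (n + 1) = a ^ (j + 1) * a ^ (n - j) := by rw [← pow_add]; congr 1; omega
      rw [this]; ring

end

/-- coefficients of `(1-w)/(1+w)` -/
def qq (k : ℕ) : ℂ := if k = 0 then 1 else 2 * (-1) ^ k

/-- the special point -/
def qc (j : ℕ) : ℂ := if j % 2 = 1 then -(2 / (j : ℂ)) else 0

lemma SS_qc : SS qc = PowerSeries.mk qq := by
  symm
  have h1 : (1 + PowerSeries.X : PowerSeries ℂ) * PowerSeries.mk qq = 1 - PowerSeries.X := by
    ext n
    rw [add_mul, one_mul, map_add, map_sub]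
    rcases n with _ | _ | n
    · simp [qq]
    · simp [qq, PowerSeries.coeff_succ_X_mul, PowerSeries.coeff_one]; norm_num
    · simp [qq, PowerSeries.coeff_succ_X_mul, PowerSeries.coeff_one, PowerSeries.coeff_X, pow_succ]
  have h2 : (1 - PowerSeries.X ^ 2 : PowerSeries ℂ) * DD qc = -2 := by
    ext n
    have e2 : (-2 : PowerSeries ℂ) = PowerSeries.C (-2) := by
      rw [map_neg, map_ofNat]
    rw [sub_mul, one_mul, map_sub, e2]
    rcases n with _ | _ | n
    · simp [DD, qc, PowerSeries.coeff_zero_eq_constantCoeff]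
    · simp [DD, qc, PowerSeries.coeff_X_pow_mul']
    · rw [show n + 1 + 1 = n + 2 from rfl, PowerSeries.coeff_X_pow_mul]
      simp only [DD, qc, PowerSeries.coeff_mk, PowerSeries.coeff_C]
      have a1 : ((n : ℂ) + 1) ≠ 0 := Nat.cast_add_one_ne_zero n
      have a2 : ((n : ℂ) + 2 + 1) ≠ 0 := by exact_mod_cast Nat.succ_ne_zero (n + 2)
      by_cases hn : (n + 1) % 2 = 1
      · rw [if_pos hn, if_pos (by omega)]; push_cast; field_simp; simp
      · rw [if_neg hn, if_neg (by omega)]; simp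
  apply SS_unique
  · simp [qq]
  · have h3 := congrArg (PowerSeries.derivative ℂ) h1
    rw [Derivation.leibniz] at h3
    simp only [map_add, map_sub, Derivation.map_one_eq_zero, PowerSeries.derivative_X,
      smul_eq_mul] at h3
    have hne : (1 + PowerSeries.X : PowerSeries ℂ) ≠ 0 := by
      intro h
      have := congrArg (PowerSeries.coeff 0) h
      simp at this
    have hne2 : (1 - PowerSeries.X : PowerSeries ℂ) ≠ 0 := by
      intro h
      have := congrArg (PowerSeries.coeff 0) h
      simp at this
    apply mul_left_cancel₀ hne
    apply mul_left_cancel₀ hne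
    linear_combination (1 + PowerSeries.X) * h3 - h1 - h2 - (1 + PowerSeries.X) * DD qc * h1

end

noncomputable section
open MvPolynomial

/-! ### Vertex operators -/

/-- `shiftMinus` as an algebra hom -/
def shA : BRing →ₐ[ℂ] Polynomial BRing :=
  MvPolynomial.aeval
    (fun i => Polynomial.C (MvPolynomial.X i) -
      Polynomial.C (MvPolynomial.C ((2 : ℂ) / ((2 * i + 1 : ℕ) : ℂ))) *
        Polynomial.X ^ (2 * i + 1))

lemma shiftMinus_eq (p : BRing) : shiftMinus p = shA p := rfl

lemma shA_X (i : ℕ) : shA (X i) = Polynomial.C (MvPolynomial.X i) -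
      Polynomial.C (MvPolynomial.C ((2 : ℂ) / ((2 * i + 1 : ℕ) : ℂ))) *
        Polynomial.X ^ (2 * i + 1) := by simp [shA]

/-- `∑ G k * P_k` -/
def Lam (G : ℕ → BRing) : Polynomial BRing →ₗ[BRing] BRing :=
  Polynomial.lsum fun k => LinearMap.mulLeft BRing (G k)

lemma Lam_monomial (G : ℕ → BRing) (k : ℕ) (a : BRing) :
    Lam G (Polynomial.monomial k a) = G k * a := by
  simp [Lam, Polynomial.lsum]

lemma Lam_mul_X_pow (G : ℕ → BRing) (j : ℕ) (P : Polynomial BRing) :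
    Lam G (P * Polynomial.X ^ j) = Lam (fun k => G (k + j)) P := by
  induction P using Polynomial.induction_on' with
  | add p q hp hq => rw [add_mul, map_add, map_add, hp, hq]
  | monomial n a => rw [Polynomial.monomial_mul_X_pow, Lam_monomial, Lam_monomial]

lemma Lam_add (G G' : ℕ → BRing) (P : Polynomial BRing) :
    Lam (fun k => G k + G' k) P = Lam G P + Lam G' P := by
  induction P using Polynomial.induction_on' with
  | add p q hp hq => rw [map_add, map_add, map_add, hp, hq]; ring
  | monomial n a => simp only [Lam_monomial]; ring

lemma Lam_smul (c : BRing) (G : ℕ → BRing) (P : Polynomial BRing) :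
    Lam (fun k => c * G k) P = c * Lam G P := by
  induction P using Polynomial.induction_on' with
  | add p q hp hq => rw [map_add, map_add, hp, hq]; ring
  | monomial n a => simp only [Lam_monomial]; ring

lemma Lam_map (g : BRing →+* BRing) (G : ℕ → BRing) (P : Polynomial BRing) :
    g (Lam G P) = Lam (fun k => g (G k)) (P.map g) := by
  induction P using Polynomial.induction_on' with
  | add p q hp hq => rw [Polynomial.map_add, map_add, map_add, map_add, hp, hq]
  | monomial n a => simp only [Lam_monomial, Polynomial.map_monomial, map_mul]

lemma Lam_eq_sum (G : ℕ → BRing) (P : Polynomial BRing) (N : ℕ) (h : P.natDegree < N) :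
    Lam G P = ∑ k ∈ Finset.range N, G k * P.coeff k := by
  conv_lhs => rw [P.as_sum_range' N h]
  rw [map_sum]
  simp only [Lam_monomial]

/-- integer-indexed coefficients -/
def cz {R : Type*} [CommRing R] (F : PowerSeries R) (n : ℤ) : R :=
  if 0 ≤ n then PowerSeries.coeff n.toNat F else 0

lemma cz_nat {R : Type*} [CommRing R] (F : PowerSeries R) (n : ℕ) :
    cz F n = PowerSeries.coeff n F := by simp [cz]

lemma cz_neg {R : Type*} [CommRing R] (F : PowerSeries R) (n : ℤ) (h : n < 0) :
    cz F n = 0 := by simp [cz, not_le.2 h]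

/-- the series `exp(∑ t_j z^j)` -/
def EE : PowerSeries BRing := SS tTilde

/-- coefficients of `f(z) exp(∑ t_j z^j)` -/
def ee (f : PowerSeries ℂ) (n : ℤ) : BRing := cz (PowerSeries.map C f * EE) n

/-- the operator `∑ f_l ψ_{m-l}` -/
def Psi (f : PowerSeries ℂ) (m : ℤ) : BRing →ₗ[ℂ] BRing :=
  ((Lam fun k => ee f (m + k)).restrictScalars ℂ).comp shA.toLinearMap

lemma Psi_apply (f : PowerSeries ℂ) (m : ℤ) (p : BRing) :
    Psi f m p = Lam (fun k => ee f (m + k)) (shA p) := rfl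

lemma ee_add (f g : PowerSeries ℂ) (n : ℤ) : ee (f + g) n = ee f n + ee g n := by
  simp only [ee, cz, map_add, add_mul]
  split_ifs <;> simp

lemma ee_smul (a : ℂ) (g : PowerSeries ℂ) (n : ℤ) : ee (a • g) n = C a * ee g n := by
  have : PowerSeries.map C (a • g) * EE = PowerSeries.C (C a) * (PowerSeries.map C g * EE) := by
    rw [PowerSeries.smul_eq_C_mul, map_mul, PowerSeries.map_C, mul_assoc]
  simp only [ee, cz, this]
  split_ifs <;> simp

lemma Psi_add (f g : PowerSeries ℂ) (m : ℤ) : Psi (f + g) m = Psi f m + Psi g m := by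
  refine LinearMap.ext fun p => ?_
  rw [LinearMap.add_apply, Psi_apply, Psi_apply, Psi_apply, ← Lam_add]
  simp only [ee_add]

lemma Psi_smul (a : ℂ) (g : PowerSeries ℂ) (m : ℤ) : Psi (a • g) m = a • Psi g m := by
  refine LinearMap.ext fun p => ?_
  rw [LinearMap.smul_apply, Psi_apply, Psi_apply, MvPolynomial.smul_eq_C_mul, ← Lam_smul]
  simp only [ee_smul]

lemma Psi_one (f : PowerSeries ℂ) (m : ℤ) : Psi f m 1 = ee f m := by
  rw [Psi_apply, map_one, ← Polynomial.monomial_zero_one, Lam_monomial]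
  simp

lemma ee_X_pow (l : ℕ) (n : ℤ) : ee (PowerSeries.X ^ l) n = ee 1 (n - l) := by
  simp only [ee, map_pow, PowerSeries.map_X, map_one, one_mul]
  by_cases h : (l : ℤ) ≤ n
  · obtain ⟨k, rfl⟩ : ∃ k : ℕ, n = (k + l : ℕ) := ⟨(n - l).toNat, by omega⟩
    have : ((k + l : ℕ) : ℤ) - l = (k : ℕ) := by push_cast; ring
    rw [this, cz_nat, cz_nat, PowerSeries.coeff_X_pow_mul]
  · rw [cz_neg _ (n - l) (by omega)]
    by_cases h0 : 0 ≤ n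
    · lift n to ℕ using h0
      rw [cz_nat, PowerSeries.coeff_X_pow_mul', if_neg (by omega)]
    · rw [cz_neg _ _ (by omega)]

lemma Psi_X_pow (l : ℕ) (m : ℤ) : Psi (PowerSeries.X ^ l) m = Psi 1 (m - l) := by
  refine LinearMap.ext fun p => ?_
  rw [Psi_apply, Psi_apply]
  congr 2
  funext k
  rw [ee_X_pow]; congr 1; ring

lemma Psi_mul_X (f : PowerSeries ℂ) (m : ℤ) (p : BRing) (i : ℕ) :
    Psi f m (p * X i) = Psi f m p * X i
      - C ((2 : ℂ) / ((2 * i + 1 : ℕ) : ℂ)) * Psi f (m + (2 * i + 1 : ℕ)) p := by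
  rw [Psi_apply, map_mul, shA_X, mul_sub, map_sub, Psi_apply, Psi_apply]
  congr 1
  · rw [mul_comm, ← Polynomial.smul_eq_C_mul, map_smul, smul_eq_mul, mul_comm]
  · rw [mul_left_comm, ← Polynomial.smul_eq_C_mul, map_smul, smul_eq_mul, Lam_mul_X_pow]
    congr 3
    funext k
    congr 1
    push_cast; ring

/-! ### action on the vacuum -/

lemma shA_tTilde (j : ℕ) : shA (tTilde j) =
    Polynomial.C (tTilde j) + Polynomial.X ^ j * algebraMap ℂ (Polynomial BRing) (qc j) := by
  unfold tTilde qc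
  split_ifs with h
  · rw [shA_X]
    have e : 2 * ((j - 1) / 2) + 1 = j := by omega
    have e2 : algebraMap ℂ (Polynomial BRing) (-(2 / (j : ℂ))) =
        Polynomial.C (C (-(2 / (j : ℂ)))) := rfl
    rw [e, e2, C_neg, Polynomial.C_neg]
    ring
  · simp

lemma SS_shA : PowerSeries.map (shA : BRing →+* Polynomial BRing) EE =
    PowerSeries.map Polynomial.C EE *
      PowerSeries.mk (fun k => Polynomial.X ^ k * algebraMap ℂ (Polynomial BRing) (qq k)) := by
  unfold EE
  rw [SS_map]
  have h1 : (fun j => shA (tTilde j)) = (fun j => (Polynomial.C (tTilde j) : Polynomial BRing)) +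
      (fun j => Polynomial.X ^ j * algebraMap ℂ (Polynomial BRing) (qc j)) := by
    funext j; exact shA_tTilde j
  rw [h1, SS_add]
  congr 1
  · exact (SS_map (Polynomial.CAlgHom : BRing →ₐ[ℂ] Polynomial BRing) tTilde).symm
  · ext1 n
    rw [SS, PowerSeries.coeff_mk, PowerSeries.coeff_mk, schur_scale]
    congr 1
    have h2 := congrArg (PowerSeries.coeff n) SS_qc
    have h3 := congrArg (PowerSeries.coeff n) (SS_map (Algebra.ofId ℂ (Polynomial BRing)) qc)
    rw [SS_qc] at h3
    simp only [SS, PowerSeries.coeff_map, PowerSeries.coeff_mk] at h3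
    exact h3.symm

lemma shA_ee (f : PowerSeries ℂ) (n K : ℕ) (hK : n < K) :
    shA (ee f n) = ∑ k ∈ Finset.range K, Polynomial.monomial k (C (qq k) * ee f ((n : ℤ) - k)) := by
  have h1 : shA (ee f n) = PowerSeries.coeff n
      (PowerSeries.map (shA : BRing →+* Polynomial BRing) (PowerSeries.map C f * EE)) := by
    rw [ee, cz_nat, PowerSeries.coeff_map]; rfl
  have h2 : PowerSeries.map (shA : BRing →+* Polynomial BRing) (PowerSeries.map C f) =
      PowerSeries.map Polynomial.C (PowerSeries.map C f) := by
    ext1 k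
    simp only [PowerSeries.coeff_map]
    exact shA.commutes _
  rw [h1, map_mul, SS_shA, h2, ← mul_assoc, ← map_mul, mul_comm, PowerSeries.coeff_mul,
    Finset.Nat.sum_antidiagonal_eq_sum_range_succ_mk]
  have h3 : Finset.range (n + 1) ⊆ Finset.range K := Finset.range_mono (by omega)
  rw [← Finset.sum_subset h3]
  · refine Finset.sum_congr rfl fun k hk => ?_
    rw [Finset.mem_range] at hk
    have : (n : ℤ) - k = ((n - k : ℕ) : ℤ) := by omega
    rw [this, ee, cz_nat, PowerSeries.coeff_mk, PowerSeries.coeff_map,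
      ← Polynomial.C_mul_X_pow_eq_monomial, Polynomial.C_mul]
    have : algebraMap ℂ (Polynomial BRing) (qq k) = Polynomial.C (C (qq k)) := rfl
    rw [this]; ring
  · intro k _ hk
    rw [Finset.mem_range] at hk
    rw [ee, cz_neg _ _ (by omega)]; simp

lemma Psi_Psi_one (f g : PowerSeries ℂ) (m n : ℤ) (K : ℕ) (hK : n < K) :
    Psi f m (Psi g n 1) = ∑ k ∈ Finset.range K, C (qq k) * (ee f (m + k) * ee g (n - k)) := by
  rw [Psi_one]
  by_cases h : 0 ≤ n
  · lift n to ℕ using h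
    rw [Psi_apply, shA_ee g n K (by omega), map_sum]
    refine Finset.sum_congr rfl fun k _ => ?_
    rw [Lam_monomial]; ring
  · have e : ee g n = 0 := by rw [ee, cz_neg _ _ (by omega)]
    rw [e, map_zero]
    symm
    refine Finset.sum_eq_zero fun k _ => ?_
    rw [ee, ee, cz_neg (PowerSeries.map C g * EE) _ (by omega)]; simp

lemma EE_neg : PowerSeries.rescale (-1 : BRing) EE * EE = 1 := by
  have : PowerSeries.rescale (-1 : BRing) EE = SS (-tTilde) := by
    ext1 n
    rw [PowerSeries.coeff_rescale, EE, SS, SS, PowerSeries.coeff_mk, PowerSeries.coeff_mk,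
      ← schur_scale]
    congr 2
    funext j
    simp only [Pi.neg_apply]
    unfold tTilde
    split_ifs with h
    · rw [(Nat.odd_iff.2 h).neg_one_pow]; ring
    · simp
  rw [this, EE, ← SS_add]; simp [SS_zero]

/-- the anticommutator scalar -/
def kap (f g : PowerSeries ℂ) (m n : ℤ) : ℂ :=
  2 * ((-1 : ℂ) ^ m * cz (PowerSeries.rescale (-1 : ℂ) f * g) (m + n))

lemma sum_ee (f g : PowerSeries ℂ) (N : ℕ) :
    ∑ k ∈ Finset.range (N + 1), (-1 : BRing) ^ k * (ee f k * ee g ((N : ℤ) - k)) =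
      C (PowerSeries.coeff N (PowerSeries.rescale (-1 : ℂ) f * g)) := by
  have h : PowerSeries.rescale (-1 : BRing) (PowerSeries.map C f * EE) * (PowerSeries.map C g * EE)
      = PowerSeries.map C (PowerSeries.rescale (-1 : ℂ) f * g) := by
    have h2 : PowerSeries.rescale (-1 : BRing) (PowerSeries.map C f) =
        PowerSeries.map C (PowerSeries.rescale (-1 : ℂ) f) := by
      ext1 n; simp [PowerSeries.coeff_rescale]
    rw [map_mul, map_mul, h2]
    linear_combination (PowerSeries.map C (PowerSeries.rescale (-1 : ℂ) f) *
      PowerSeries.map C g) * EE_neg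
  have h4 := congrArg (PowerSeries.coeff N) h
  rw [PowerSeries.coeff_map, PowerSeries.coeff_mul,
    Finset.Nat.sum_antidiagonal_eq_sum_range_succ_mk] at h4
  rw [← h4]
  refine Finset.sum_congr rfl fun k hk => ?_
  rw [Finset.mem_range] at hk
  have : (N : ℤ) - k = ((N - k : ℕ) : ℤ) := by omega
  rw [this, ee, ee, cz_nat, cz_nat, PowerSeries.coeff_rescale]; ring

lemma sum_sym (b : ℤ → BRing) (K : ℕ) :
    ∑ k ∈ Finset.range (K + 1), b k + ∑ k ∈ Finset.range (K + 1), b (-k) =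
      b 0 + ∑ i ∈ Finset.range (2 * K + 1), b ((i : ℤ) - K) := by
  induction K with
  | zero => simp
  | succ K ih =>
    rw [Finset.sum_range_succ, Finset.sum_range_succ (fun k : ℕ => b (-k)),
      show 2 * (K + 1) + 1 = (2 * K + 1) + 1 + 1 by ring, Finset.sum_range_succ _ (2 * K + 1 + 1),
      Finset.sum_range_succ' _ (2 * K + 1)]
    have e1 : ∀ i : ℕ, ((i + 1 : ℕ) : ℤ) - ((K + 1 : ℕ) : ℤ) = (i : ℤ) - K := by
      intro i; push_cast; ring
    have e2 : ((2 * K + 1 : ℕ) : ℤ) - (K : ℤ) = ((K + 1 : ℕ) : ℤ) := by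
      push_cast; ring
    have e3 : ((0 : ℕ) : ℤ) - ((K + 1 : ℕ) : ℤ) = -((K + 1 : ℕ) : ℤ) := by
      push_cast; ring
    simp only [e1, e2, e3]
    linear_combination ih

lemma sum_qq (a : ℤ → BRing) (s : ℤ) (K : ℕ) :
    ∑ k ∈ Finset.range (K + 1), C (qq k) * a (s * k) =
      2 * ∑ k ∈ Finset.range (K + 1), (-1 : BRing) ^ k * a (s * k) - a 0 := by
  rw [Finset.sum_range_succ', Finset.sum_range_succ', mul_add, Finset.mul_sum]
  have : ∀ k : ℕ, C (qq (k + 1)) * a (s * (k + 1 : ℕ)) =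
      2 * ((-1 : BRing) ^ (k + 1) * a (s * (k + 1 : ℕ))) := by
    intro k
    rw [qq, if_neg (Nat.succ_ne_zero k)]
    simp only [map_mul, map_pow, map_neg, map_one, map_ofNat]
    ring
  simp only [this]
  simp [qq]
  ring

lemma Psi_anti_one (f g : PowerSeries ℂ) (m n : ℤ) :
    Psi f m (Psi g n 1) + Psi g n (Psi f m 1) = C (kap f g m n) := by
  obtain ⟨K, hm, hn, hm', hn'⟩ : ∃ K : ℕ, m ≤ K ∧ n ≤ K ∧ -m ≤ K ∧ -n ≤ K :=
    ⟨m.natAbs + n.natAbs, by omega, by omega, by omega, by omega⟩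
  rw [Psi_Psi_one f g m n (K + 1) (by push_cast; omega),
    Psi_Psi_one g f n m (K + 1) (by push_cast; omega)]
  have h1 := sum_qq (fun k => ee f (m + k) * ee g (n - k)) 1 K
  have h2 := sum_qq (fun k => ee f (m + k) * ee g (n - k)) (-1) K
  have h3 := sum_sym (fun k => (-1 : BRing) ^ k.natAbs * (ee f (m + k) * ee g (n - k))) K
  simp only [one_mul, neg_mul, Int.natAbs_natCast, Int.natAbs_neg, sub_neg_eq_add,
    ← sub_eq_add_neg, Int.natAbs_zero, pow_zero, add_zero, sub_zero] at h1 h2 h3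
  have h4 : ∑ k ∈ Finset.range (K + 1), C (qq k) * (ee g (n + k) * ee f (m - k)) =
      ∑ k ∈ Finset.range (K + 1), C (qq k) * (ee f (m - k) * ee g (n + k)) :=
    Finset.sum_congr rfl fun k _ => by ring
  rw [h4, h1, h2]
  have h5 : 2 * ∑ i ∈ Finset.range (2 * K + 1), (-1 : BRing) ^ ((i : ℤ) - K).natAbs *
      (ee f (m + (i - K)) * ee g (n - (i - K))) = C (kap f g m n) := by
    by_cases hN : 0 ≤ m + n
    · obtain ⟨N, hN⟩ := Int.eq_ofNat_of_zero_le hN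
      obtain ⟨D, hD⟩ : ∃ D : ℕ, (D : ℤ) = K - m := ⟨(K - m).toNat, by omega⟩
      obtain ⟨D', hD'⟩ : ∃ D' : ℕ, (D' : ℤ) = K - n := ⟨(K - n).toNat, by omega⟩
      have e : 2 * K + 1 = D + (N + 1) + D' := by omega
      rw [e, Finset.sum_range_add, Finset.sum_range_add]
      have z1 : ∑ i ∈ Finset.range D, (-1 : BRing) ^ ((i : ℤ) - K).natAbs *
          (ee f (m + (i - K)) * ee g (n - (i - K))) = 0 := by
        refine Finset.sum_eq_zero fun i hi => ?_
        rw [Finset.mem_range] at hi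
        rw [ee, cz_neg _ _ (by omega)]; simp
      have z2 : ∑ i ∈ Finset.range D', (-1 : BRing) ^ (((D + (N + 1) + i : ℕ) : ℤ) - K).natAbs *
          (ee f (m + ((D + (N + 1) + i : ℕ) - K)) * ee g (n - ((D + (N + 1) + i : ℕ) - K))) = 0 := by
        refine Finset.sum_eq_zero fun i hi => ?_
        rw [ee, ee, cz_neg (PowerSeries.map C g * EE) _ (by push_cast; omega)]; simp
      rw [z1, z2, zero_add, add_zero, kap, hN, cz_nat]
      rw [map_mul, map_mul, ← sum_ee, map_ofNat]
      refine congrArg (fun y : BRing => 2 * y) ?_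
      rw [Finset.mul_sum]
      refine Finset.sum_congr rfl fun i _ => ?_
      have a1 : m + (((D + i : ℕ) : ℤ) - K) = i := by push_cast; omega
      have a2 : n - (((D + i : ℕ) : ℤ) - K) = N - i := by push_cast; omega
      rw [a1, a2]
      have a3 : (-1 : BRing) ^ (((D + i : ℕ) : ℤ) - K).natAbs = C ((-1 : ℂ) ^ m) * (-1) ^ i := by
        have a4 : ((D + i : ℕ) : ℤ) - K = i - m := by push_cast; omega
        rw [a4]
        have a5 : ∀ (x : ℤ), (-1 : BRing) ^ x.natAbs = C ((-1 : ℂ) ^ x) := by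
          intro x
          rcases Int.even_or_odd x with hx | hx
          · rw [hx.neg_one_zpow, (Int.natAbs_even.2 hx).neg_one_pow]; simp
          · rw [hx.neg_one_zpow, (Int.natAbs_odd.2 hx).neg_one_pow]; simp
        rw [a5, zpow_sub₀ (by norm_num)]
        have a6 : ((-1 : ℂ) ^ m)⁻¹ = (-1) ^ m := by
          rcases Int.even_or_odd m with hx | hx
          · rw [hx.neg_one_zpow]; simp
          · rw [hx.neg_one_zpow]; norm_num
        rw [div_eq_mul_inv, a6, map_mul]
        simp [mul_comm]
      rw [a3]; ring
    · rw [kap, cz_neg _ _ (by omega)]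
      simp only [mul_zero, map_zero]
      rw [Finset.sum_eq_zero, mul_zero]
      intro i _
      by_cases hi : m + ((i : ℤ) - K) < 0
      · rw [ee, cz_neg _ _ hi]; simp
      · rw [ee, ee, cz_neg (PowerSeries.map C g * EE) _ (by omega)]; simp
  rw [← h5]
  linear_combination 2 * h3

lemma kap_shift (f g : PowerSeries ℂ) (m n : ℤ) (i : ℕ) :
    kap f g (m + (2 * i + 1 : ℕ)) n + kap f g m (n + (2 * i + 1 : ℕ)) = 0 := by
  unfold kap
  have h : (-1 : ℂ) ^ (m + (2 * i + 1 : ℕ)) = - (-1) ^ m := by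
    rw [zpow_add₀ (by norm_num), zpow_natCast, pow_succ, pow_mul]; simp
  rw [h, show m + ((2 * i + 1 : ℕ) : ℤ) + n = m + (n + (2 * i + 1 : ℕ)) by ring]
  ring

lemma Psi_anti (f g : PowerSeries ℂ) (m n : ℤ) (p : BRing) :
    Psi f m (Psi g n p) + Psi g n (Psi f m p) = C (kap f g m n) * p := by
  induction p using MvPolynomial.induction_on generalizing m n with
  | C a =>
    have e : (C a : BRing) = a • 1 := by rw [MvPolynomial.smul_eq_C_mul, mul_one]
    rw [e, map_smul, map_smul, map_smul, map_smul, ← smul_add, Psi_anti_one,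
      MvPolynomial.smul_eq_C_mul, MvPolynomial.smul_eq_C_mul]
    ring
  | add p q hp hq =>
    simp only [map_add]
    linear_combination hp m n + hq m n
  | mul_X p i ih =>
    rw [Psi_mul_X, Psi_mul_X, map_sub, map_sub, Psi_mul_X, Psi_mul_X]
    simp only [← MvPolynomial.smul_eq_C_mul, map_smul]
    simp only [MvPolynomial.smul_eq_C_mul]
    have h1 := ih m n
    have h2 := ih (m + (2 * i + 1 : ℕ)) n
    have h3 := ih m (n + (2 * i + 1 : ℕ))
    have h4 := congrArg (C : ℂ → BRing) (kap_shift f g m n i)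
    rw [map_add, map_zero] at h4
    linear_combination X i * h1 - C (2 / ((2 * i + 1 : ℕ) : ℂ)) * (h2 + h3 + p * h4)

end

noncomputable section
open MvPolynomial
open scoped TensorProduct

/-! ### relation with the bilinear identity -/

lemma ee_one (n : ℤ) : ee 1 n = sTildeZ n := by
  simp [ee, cz, sTildeZ, EE, SS]

lemma Psi_eq_sum (m : ℤ) (p : BRing) (N : ℕ) (h : (shA p).natDegree < N) :
    Psi 1 m p = ∑ k ∈ Finset.range N, sTildeZ (m + k) * (shA p).coeff k := by
  rw [Psi_apply, Lam_eq_sum _ _ N h]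
  simp only [ee_one]

lemma leftCoeff_eq (p : BRing) (m : ℤ) : leftCoeff p m = Psi 1 m p := by
  rw [Psi_eq_sum m p _ (Nat.lt_succ_self _), leftCoeff]
  apply finsum_eq_sum_of_support_subset
  intro k hk
  rw [Finset.coe_range, Set.mem_Iio]
  by_contra hlt
  apply hk
  simp only [shiftMinus_eq]
  rw [Polynomial.coeff_eq_zero_of_natDegree_lt (by omega), mul_zero]

lemma shiftPlus_eq (p : BRing) :
    shiftPlus p = (shA p).comp (Polynomial.C (-1) * Polynomial.X) := by
  have : ((MvPolynomial.aeval
    (fun i => Polynomial.C (MvPolynomial.X i) +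
      Polynomial.C (MvPolynomial.C ((2 : ℂ) / ((2 * i + 1 : ℕ) : ℂ))) *
        Polynomial.X ^ (2 * i + 1)) : BRing →ₐ[ℂ] Polynomial BRing) : BRing →+* Polynomial BRing) =
      (Polynomial.compRingHom (Polynomial.C (-1) * Polynomial.X) :
        Polynomial BRing →+* Polynomial BRing).comp (shA : BRing →+* Polynomial BRing) := by
    apply MvPolynomial.ringHom_ext
    · intro r
      have h1 : shA (C r) = Polynomial.C (C r) := shA.commutes r
      simp [h1]
    · intro i
      simp only [RingHom.coe_comp, RingHom.coe_coe, Function.comp_apply, shA_X, aeval_X,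
        Polynomial.coe_compRingHom_apply, Polynomial.sub_comp, Polynomial.mul_comp,
        Polynomial.C_comp, Polynomial.X_pow_comp, mul_pow]
      rw [← Polynomial.C_pow, (odd_two_mul_add_one i).neg_one_pow, Polynomial.C_neg,
        Polynomial.C_1]
      ring
  exact congrArg (fun g : BRing →+* Polynomial BRing => g p) this

lemma shiftPlus_coeff (p : BRing) (k : ℕ) :
    (shiftPlus p).coeff k = (-1) ^ k * (shA p).coeff k := by
  rw [shiftPlus_eq, Polynomial.comp_C_mul_X_coeff, mul_comm]

lemma sTildeNegZ_eq (n : ℤ) : sTildeNegZ n = (-1) ^ n.natAbs * sTildeZ n := by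
  unfold sTildeNegZ sTildeZ
  split_ifs with h
  · have e : n.natAbs = n.toNat := by omega
    rw [e, ← schur_scale]
    congr 2
    funext j
    unfold tTilde
    split_ifs with h
    · rw [(Nat.odd_iff.2 h).neg_one_pow]; ring
    · simp
  · simp

lemma neg_one_natAbs (m : ℤ) : (-1 : BRing) ^ m.natAbs = C ((-1 : ℂ) ^ m) := by
  rcases Int.even_or_odd m with hx | hx
  · rw [hx.neg_one_zpow, (Int.natAbs_even.2 hx).neg_one_pow]; simp
  · rw [hx.neg_one_zpow, (Int.natAbs_odd.2 hx).neg_one_pow]; simp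

lemma rightCoeff_eq (p : BRing) (m : ℤ) : rightCoeff p m = ((-1 : ℂ) ^ m) • Psi 1 m p := by
  rw [Psi_eq_sum m p _ (Nat.lt_succ_self _), rightCoeff, Finset.smul_sum]
  have key : ∀ k : ℕ, sTildeNegZ (m + k) * (shiftPlus p).coeff k =
      ((-1 : ℂ) ^ m) • (sTildeZ (m + k) * (shA p).coeff k) := by
    intro k
    rw [shiftPlus_coeff, sTildeNegZ_eq, neg_one_natAbs, MvPolynomial.smul_eq_C_mul,
      zpow_add₀ (by norm_num), zpow_natCast, map_mul]
    have h2 : (C ((-1 : ℂ) ^ k) : BRing) * (-1) ^ k = 1 := by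
      rw [map_pow, map_neg, map_one, ← mul_pow]; simp
    linear_combination (C ((-1 : ℂ) ^ m) * sTildeZ (m + k) * (shA p).coeff k) * h2
  simp only [key]
  apply finsum_eq_sum_of_support_subset
  intro k hk
  rw [Finset.coe_range, Set.mem_Iio]
  by_contra hlt
  apply hk
  simp only
  rw [Polynomial.coeff_eq_zero_of_natDegree_lt (by omega), mul_zero, smul_zero]

lemma Psi_low (m : ℤ) (p : BRing) (h : ((shA p).natDegree : ℤ) < -m) : Psi 1 m p = 0 := by
  rw [Psi_eq_sum m p _ (Nat.lt_succ_self _)]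
  refine Finset.sum_eq_zero fun k hk => ?_
  rw [Finset.mem_range] at hk
  rw [sTildeZ, if_neg (by omega), zero_mul]

lemma Psi_lead (p : BRing) :
    Psi 1 (-((shA p).natDegree : ℤ)) p = (shA p).coeff (shA p).natDegree := by
  rw [Psi_eq_sum _ p _ (Nat.lt_succ_self _), Finset.sum_range_succ, Finset.sum_eq_zero, zero_add]
  · simp [sTildeZ, schurPoly]
  · intro k hk
    rw [Finset.mem_range] at hk
    rw [sTildeZ, if_neg (by omega), zero_mul]

lemma shA_coeff_zero (p : BRing) : (shA p).coeff 0 = p := by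
  have : (Polynomial.constantCoeff : Polynomial BRing →+* BRing).comp
      (shA : BRing →+* Polynomial BRing) = RingHom.id _ := by
    apply MvPolynomial.ringHom_ext
    · intro r
      have : shA (C r) = Polynomial.C (C r) := shA.commutes r
      simp [this]
    · intro i
      simp [shA_X]
  exact congrArg (fun g : BRing →+* BRing => g p) this

/-- defect of the chain rule -/
def chainD (n : ℕ) (p : BRing) : Polynomial BRing :=
  Polynomial.derivative (shA p) +
    2 * ∑ i ∈ Finset.range n, Polynomial.X ^ (2 * i) * shA (pderiv i p)

lemma chainD_add (n : ℕ) (p q : BRing) : chainD n (p + q) = chainD n p + chainD n q := by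
  simp only [chainD, map_add, mul_add, Finset.sum_add_distrib]; ring

lemma chainD_mul (n : ℕ) (p q : BRing) :
    chainD n (p * q) = chainD n p * shA q + shA p * chainD n q := by
  simp only [chainD, map_mul, Polynomial.derivative_mul, Derivation.leibniz, smul_eq_mul,
    map_add, mul_add, Finset.sum_add_distrib, add_mul, Finset.mul_sum, Finset.sum_mul]
  have e1 : ∀ i, 2 * (Polynomial.X ^ (2 * i) * (shA p * shA (pderiv i q))) =
      shA p * (2 * (Polynomial.X ^ (2 * i) * shA (pderiv i q))) := by intro i; ring
  have e2 : ∀ i, 2 * (Polynomial.X ^ (2 * i) * (shA q * shA (pderiv i p))) =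
      2 * (Polynomial.X ^ (2 * i) * shA (pderiv i p)) * shA q := by intro i; ring
  simp only [e1, e2]
  ring

lemma chainD_X (n j : ℕ) : (Polynomial.X : Polynomial BRing) ^ (2 * n) ∣ chainD n (X j) := by
  have h1 : Polynomial.derivative (shA (X j)) = -(Polynomial.C 2 * Polynomial.X ^ (2 * j)) := by
    rw [shA_X]
    simp only [Polynomial.derivative_sub, Polynomial.derivative_C, Polynomial.derivative_C_mul,
      Polynomial.derivative_X_pow, zero_sub, Nat.add_sub_cancel, ← mul_assoc, ← Polynomial.C_mul]
    have : (C (2 / ((2 * j + 1 : ℕ) : ℂ)) * ((2 * j + 1 : ℕ) : BRing)) = 2 := by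
      have e : ((2 * j + 1 : ℕ) : BRing) = C ((2 * j + 1 : ℕ) : ℂ) := (map_natCast C _).symm
      rw [e, ← C_mul, div_mul_cancel₀ _ (Nat.cast_ne_zero.2 (by omega))]
      exact map_ofNat C 2
    rw [this]
  have h2 : ∀ i, Polynomial.X ^ (2 * i) * shA (pderiv i (X j)) =
      if i = j then (Polynomial.X : Polynomial BRing) ^ (2 * j) else 0 := by
    intro i
    split_ifs with h
    · subst h; rw [pderiv_X_self, map_one, mul_one]
    · rw [pderiv_X_of_ne (Ne.symm h), map_zero, mul_zero]
  rw [chainD, h1, Finset.sum_congr rfl fun i _ => h2 i, Finset.sum_ite_eq']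
  have e2 : (Polynomial.C 2 : Polynomial BRing) = 2 := map_ofNat Polynomial.C 2
  split_ifs with h
  · rw [e2]
    have : -(2 * Polynomial.X ^ (2 * j)) + 2 * Polynomial.X ^ (2 * j) = (0 : Polynomial BRing) := by
      ring
    rw [this]; exact dvd_zero _
  · rw [mul_zero, add_zero]
    rw [Finset.mem_range] at h
    exact (Dvd.dvd.mul_left (pow_dvd_pow _ (by omega)) _).neg_right

lemma chainD_dvd (n : ℕ) (p : BRing) : (Polynomial.X : Polynomial BRing) ^ (2 * n) ∣ chainD n p := by
  induction p using MvPolynomial.induction_on with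
  | C a =>
    have : shA (C a) = Polynomial.C (C a) := shA.commutes a
    simp [chainD, this]
  | add p q hp hq => rw [chainD_add]; exact dvd_add hp hq
  | mul_X p i ih =>
    rw [chainD_mul]
    exact dvd_add (ih.mul_right _) ((chainD_X n i).mul_left _)

lemma const_of_deg_zero (p : BRing) (h : (shA p).natDegree = 0) : ∃ a : ℂ, p = C a := by
  have hd : ∀ i, pderiv i p = 0 := by
    intro i
    induction i using Nat.strong_induction_on with
    | _ i ih =>
      have h1 := chainD_dvd (i + 1) p
      rw [chainD, Polynomial.derivative_of_natDegree_zero h, zero_add, Finset.sum_range_succ,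
        Finset.sum_eq_zero, zero_add] at h1
      · rw [Polynomial.X_pow_dvd_iff] at h1
        have h2 := h1 (2 * i) (by omega)
        rw [← map_ofNat (Polynomial.C : BRing →+* Polynomial BRing) 2, Polynomial.coeff_C_mul] at h2
        have h3 := Polynomial.coeff_X_pow_mul (shA (pderiv i p)) (2 * i) 0
        rw [zero_add] at h3
        rw [h3, shA_coeff_zero] at h2
        simpa using h2
      · intro j hj
        rw [ih j (Finset.mem_range.1 hj)]; simp
  refine ⟨coeff 0 p, ?_⟩
  ext m
  rw [coeff_C]
  split_ifs with h0
  · rw [h0]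
  · obtain ⟨i, hi⟩ : ∃ i, m i ≠ 0 := by
      by_contra hc
      push Not at hc
      exact h0 (Finsupp.ext fun i => (hc i).symm)
    have h1 := coeff_pderiv (i := i) p (m - Finsupp.single i 1)
    rw [hd i] at h1
    have h2 : m - Finsupp.single i 1 + Finsupp.single i 1 = m := by
      apply tsub_add_cancel_of_le
      rw [Finsupp.single_le_iff]; omega
    rw [h2, coeff_zero] at h1
    rcases mul_eq_zero.1 h1.symm with h3 | h3
    · exact h3
    · exact absurd h3 (Nat.cast_add_one_ne_zero _)

/-! ### tensor form of the bilinear identity -/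

/-- tensor form of the BKP identity -/
def BK (p : BRing) : Prop :=
  ∃ M0 : ℕ, ∀ M : ℕ, M0 ≤ M → ∑ m ∈ Finset.Icc (-(M : ℤ)) M,
    ((-1 : ℂ) ^ m) • (Psi 1 m p ⊗ₜ[ℂ] Psi 1 (-m) p) = p ⊗ₜ[ℂ] p

/-- the map to the tensor product -/
def toTen : BRing2 →ₐ[ℂ] (BRing ⊗[ℂ] BRing) :=
  aeval (Sum.elim (fun i => (X i : BRing) ⊗ₜ[ℂ] (1 : BRing)) (fun i => (1 : BRing) ⊗ₜ[ℂ] (X i : BRing)))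

lemma toTen_inL (p : BRing) : toTen (inL p) = p ⊗ₜ[ℂ] 1 := by
  have : toTen.comp (rename Sum.inl) =
      (Algebra.TensorProduct.includeLeft : BRing →ₐ[ℂ] BRing ⊗[ℂ] BRing) := by
    apply MvPolynomial.algHom_ext
    intro i
    simp [toTen]
  exact congrArg (fun g : BRing →ₐ[ℂ] BRing ⊗[ℂ] BRing => g p) this

lemma toTen_inR (p : BRing) : toTen (inR p) = 1 ⊗ₜ[ℂ] p := by
  have : toTen.comp (rename Sum.inr) =
      (Algebra.TensorProduct.includeRight : BRing →ₐ[ℂ] BRing ⊗[ℂ] BRing) := by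
    apply MvPolynomial.algHom_ext
    intro i
    simp [toTen]
  exact congrArg (fun g : BRing →ₐ[ℂ] BRing ⊗[ℂ] BRing => g p) this

lemma toTen_mul (p q : BRing) : toTen (inL p * inR q) = p ⊗ₜ[ℂ] q := by
  rw [map_mul, toTen_inL, toTen_inR, Algebra.TensorProduct.tmul_mul_tmul, one_mul, mul_one]

lemma BK_of (p : BRing) (h : SatisfiesBKP p) : BK p := by
  refine ⟨(shA p).natDegree, fun M hM => ?_⟩
  unfold SatisfiesBKP at h
  rw [finsum_eq_sum_of_support_subset (s := Finset.Icc (-(M : ℤ)) M)] at h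
  · have h2 := congrArg toTen h
    rw [map_sum, toTen_mul] at h2
    rw [← h2]
    refine Finset.sum_congr rfl fun m _ => ?_
    rw [toTen_mul, leftCoeff_eq, rightCoeff_eq, TensorProduct.tmul_smul]
    congr 1
    rcases Int.even_or_odd m with hx | hx
    · rw [hx.neg_one_zpow, hx.neg.neg_one_zpow]
    · rw [hx.neg_one_zpow, hx.neg.neg_one_zpow]
  · intro m hm
    rw [Finset.coe_Icc, Set.mem_Icc]
    by_contra hlt
    apply hm
    simp only [leftCoeff_eq, rightCoeff_eq]
    by_cases h1 : m < -(M : ℤ)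
    · rw [Psi_low m p (by omega), map_zero, zero_mul]
    · rw [Psi_low (-m) p (by omega), smul_zero, map_zero, mul_zero]

end

noncomputable section
open MvPolynomial
open scoped TensorProduct

/-! ### structure theorem -/

/-- product of operators applied to a vector -/
def vac : (k : ℕ) → (Fin k → (BRing →ₗ[ℂ] BRing)) → BRing → BRing
  | 0, _, p => p
  | k + 1, v, p => v 0 (vac k (fun i => v i.succ) p)

lemma exists_SS (f : PowerSeries ℂ) (h : PowerSeries.coeff 0 f = 1) : ∃ c : ℕ → ℂ, f = SS c := by
  refine ⟨fun j => PowerSeries.coeff (j - 1) (PowerSeries.derivative ℂ f * f⁻¹) / (j : ℂ), ?_⟩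
  apply SS_unique _ _ h
  have h1 : f⁻¹ * f = 1 := by
    apply PowerSeries.inv_mul_cancel
    rw [← PowerSeries.coeff_zero_eq_constantCoeff_apply, h]; exact one_ne_zero
  have h2 : DD (fun j => PowerSeries.coeff (j - 1) (PowerSeries.derivative ℂ f * f⁻¹) / (j : ℂ)) =
      PowerSeries.derivative ℂ f * f⁻¹ := by
    ext n
    simp only [DD, PowerSeries.coeff_mk, Nat.add_sub_cancel]
    push_cast
    exact mul_div_cancel₀ _ (Nat.cast_add_one_ne_zero n)
  rw [h2, mul_assoc, h1, mul_one]

lemma kap_one (m n : ℤ) : kap 1 1 m n = if m + n = 0 then 2 * (-1 : ℂ) ^ m else 0 := by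
  unfold kap
  rw [map_one, one_mul]
  split_ifs with h
  · rw [h]; simp [cz]
  · have : cz (1 : PowerSeries ℂ) (m + n) = 0 := by
      unfold cz
      split_ifs with h2
      · rw [PowerSeries.coeff_one, if_neg (by omega)]
      · rfl
    rw [this]; ring

lemma Psi_sum {ι : Type*} (s : Finset ι) (a : ι → ℂ) (l : ι → ℕ) (m : ℤ) (p : BRing) :
    Psi (∑ i ∈ s, a i • PowerSeries.X ^ (l i)) m p = ∑ i ∈ s, a i • Psi 1 (m - l i) p := by
  classical
  induction s using Finset.induction_on with
  | empty =>
    have := Psi_smul 0 1 m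
    simp only [zero_smul] at this
    simp [this]
  | insert i s hi ih =>
    rw [Finset.sum_insert hi, Finset.sum_insert hi, Psi_add, Psi_smul, Psi_X_pow,
      LinearMap.add_apply, ih, LinearMap.smul_apply]

lemma psi_anti (m n : ℤ) (p : BRing) :
    Psi 1 m (Psi 1 n p) = (if m + n = 0 then 2 * (-1 : ℂ) ^ m else 0) • p - Psi 1 n (Psi 1 m p) := by
  rw [eq_sub_iff_add_eq, Psi_anti, kap_one, ← smul_eq_C_mul]

lemma step_sq (n : ℕ) (hn : 0 < n) (p : BRing) : Psi 1 (-(n : ℤ)) (Psi 1 (-(n:ℤ)) p) = 0 := by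
  have h := psi_anti (-(n:ℤ)) (-(n:ℤ)) p
  rw [if_neg (by omega), zero_smul, zero_sub] at h
  exact CharZero.eq_neg_self_iff.1 h

lemma step_term (n : ℕ) (hn : 0 < n) (τ : BRing) (m : ℤ) :
    Psi 1 m (Psi 1 (-(n:ℤ)) τ) ⊗ₜ[ℂ] Psi 1 (-m) (Psi 1 (-(n:ℤ)) τ) =
    Psi 1 (-(n:ℤ)) (Psi 1 m τ) ⊗ₜ[ℂ] Psi 1 (-(n:ℤ)) (Psi 1 (-m) τ) := by
  have sq := step_sq n hn τ
  by_cases hm : m = n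
  · rw [hm, sq, TensorProduct.tmul_zero, TensorProduct.tmul_zero]
  by_cases hm' : m = -n
  · rw [hm', sq, TensorProduct.zero_tmul, TensorProduct.zero_tmul]
  have e1 : Psi 1 (-(n:ℤ)) (Psi 1 m τ) = - Psi 1 m (Psi 1 (-(n:ℤ)) τ) := by
    rw [psi_anti, if_neg (by omega), zero_smul, zero_sub]
  have e2 : Psi 1 (-(n:ℤ)) (Psi 1 (-m) τ) = - Psi 1 (-m) (Psi 1 (-(n:ℤ)) τ) := by
    rw [psi_anti, if_neg (by omega), zero_smul, zero_sub]
  rw [e1, e2, TensorProduct.neg_tmul, TensorProduct.tmul_neg, neg_neg]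

lemma step_BK (n : ℕ) (hn : 0 < n) (τ : BRing) (h : BK τ) : BK (Psi 1 (-(n:ℤ)) τ) := by
  obtain ⟨M0, h0⟩ := h
  refine ⟨M0, fun M hM => ?_⟩
  have h1 := congrArg (TensorProduct.map (Psi 1 (-(n:ℤ))) (Psi 1 (-(n:ℤ)))) (h0 M hM)
  simp only [map_sum, map_smul, TensorProduct.map_tmul] at h1
  rw [← h1]
  exact Finset.sum_congr rfl fun m _ => congrArg (fun q => ((-1 : ℂ) ^ m) • q) (step_term n hn τ m)

lemma sum_reindex (n M : ℕ) (hM : n ≤ M) (g : ℤ → BRing) (hg : ∀ m : ℤ, (n : ℤ) < m → g m = 0) :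
    ∑ m ∈ Finset.Icc (-(M : ℤ)) M, g m = ∑ l ∈ Finset.range (M + n + 1), g (n - l) := by
  rw [← Finset.sum_image (s := Finset.range (M + n + 1)) (g := fun l : ℕ => (n : ℤ) - l) (f := g)]
  · symm
    apply Finset.sum_subset
    · intro m hm
      simp only [Finset.mem_image, Finset.mem_range, Finset.mem_Icc] at hm ⊢
      obtain ⟨a, ha, rfl⟩ := hm
      omega
    · intro m hm hm'
      apply hg
      by_contra hc
      apply hm'
      simp only [Finset.mem_image, Finset.mem_range, Finset.mem_Icc] at hm ⊢
      exact ⟨(n - m).toNat, by omega, by omega⟩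
  · intro a _ b _ hab
    simp only at hab
    omega

lemma step_form (n : ℕ) (hn : 0 < n) (τ : BRing) (h : BK τ)
    (hv : ∀ j : ℕ, n < j → Psi 1 (-(j:ℤ)) τ = 0) (hne : Psi 1 (-(n:ℤ)) τ ≠ 0) :
    ∃ (a : ℂ) (c : ℕ → ℂ), a ≠ 0 ∧ τ = a • Psi (SS c) n (Psi 1 (-(n:ℤ)) τ) := by
  obtain ⟨M0, h0⟩ := h
  set τ' := Psi 1 (-(n:ℤ)) τ with hτ'
  have sq : Psi 1 (-(n:ℤ)) τ' = 0 := step_sq n hn τ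
  have hns : τ' ∉ Submodule.span ℂ {τ} := by
    intro hmem
    obtain ⟨a, ha⟩ := Submodule.mem_span_singleton.1 hmem
    have h1 := congrArg (Psi 1 (-(n:ℤ))) ha
    rw [map_smul, sq, ← hτ'] at h1
    rcases smul_eq_zero.1 h1 with h2 | h2
    · rw [h2, zero_smul] at ha; exact hne ha.symm
    · exact hne h2
  obtain ⟨f, hf1, hf2⟩ := Submodule.exists_le_ker_of_notMem hns
  have hfτ : f τ = 0 := hf2 (Submodule.mem_span_singleton_self τ)
  set M := max M0 n with hMdef
  have h1 := congrArg (TensorProduct.map (Psi 1 (-(n:ℤ))) (LinearMap.id : BRing →ₗ[ℂ] BRing))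
    (h0 M (le_max_left _ _))
  have h2 := congrArg (TensorProduct.rid ℂ BRing) (congrArg (TensorProduct.map
    (LinearMap.id : BRing →ₗ[ℂ] BRing) f) h1)
  simp only [map_sum, map_smul, TensorProduct.map_tmul, LinearMap.id_apply,
    TensorProduct.rid_tmul, hfτ, zero_smul] at h2
  have hnM : n ≤ M := le_max_right _ _
  rw [sum_reindex n M hnM] at h2
  swap
  · intro m hm
    have := hv m.toNat (by omega)
    rw [Int.toNat_of_nonneg (by omega)] at this
    rw [this]; simp
  have h3 : ∀ l : ℕ, Psi 1 (-(n:ℤ)) (Psi 1 ((n:ℤ) - l) τ) =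
      (if l = 0 then 2 * (-1 : ℂ) ^ (-(n:ℤ)) else 0) • τ - Psi 1 ((n:ℤ) - l) τ' := by
    intro l
    rw [psi_anti]
    congr 2
    by_cases hl : l = 0
    · rw [if_pos hl, if_pos (by omega)]
    · rw [if_neg hl, if_neg (by omega)]
  simp only [h3, smul_sub, Finset.sum_sub_distrib] at h2
  rw [Finset.sum_eq_single 0] at h2
  rotate_left
  · intro b _ hb
    rw [if_neg hb]; simp
  · intro hb; exact absurd (Finset.mem_range.2 (by omega)) hb
  have e0 : ((-1:ℂ) ^ n) * (-1) ^ n = 1 := by rw [← mul_pow]; simp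
  have e1 : (-1 : ℂ) ^ (-(n:ℤ)) = (-1) ^ n := by
    rw [zpow_neg, zpow_natCast, ← inv_pow]; norm_num
  have e2 : ∀ l : ℕ, (-1 : ℂ) ^ ((n:ℤ) - l) = (-1) ^ n * (-1) ^ l := by
    intro l
    rw [zpow_sub₀ (by norm_num), zpow_natCast, zpow_natCast, div_eq_mul_inv, ← inv_pow]; norm_num
  set b : ℕ → ℂ := fun l => (f τ')⁻¹ * ((-1) ^ l * f (Psi 1 (-((n:ℤ) - l)) τ)) with hb
  have hb0 : b 0 = 1 := by
    simp only [hb, pow_zero, one_mul, Nat.cast_zero, sub_zero]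
    rw [← hτ']; exact inv_mul_cancel₀ hf1
  set g : PowerSeries ℂ := ∑ l ∈ Finset.range (M + n + 1), b l • PowerSeries.X ^ l with hg
  have hg0 : PowerSeries.coeff 0 g = 1 := by
    rw [hg, map_sum, Finset.sum_eq_single 0]
    · simp [hb0]
    · intro l _ hl
      simp [PowerSeries.coeff_X_pow, hl.symm, hl]
    · intro hb; exact absurd (Finset.mem_range.2 (by omega)) hb
  obtain ⟨c, hc⟩ := exists_SS g hg0
  have hP : Psi (SS c) n τ' = ∑ l ∈ Finset.range (M + n + 1), b l • Psi 1 ((n:ℤ) - l) τ' := by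
    rw [← hc, hg, Psi_sum]
  refine ⟨2⁻¹ * (-1) ^ n, c, ?_, ?_⟩
  · exact mul_ne_zero (by norm_num) (pow_ne_zero _ (by norm_num))
  rw [hP, Finset.smul_sum]
  simp only [if_true, Nat.cast_zero, sub_zero] at h2
  rw [← hτ', sub_eq_zero, zpow_natCast, e1, smul_smul, smul_smul] at h2
  have h5 := congrArg (fun q => (2⁻¹ * (f τ')⁻¹) • q) h2
  simp only [Finset.smul_sum, smul_smul, e2] at h5
  have e3 : (2⁻¹ * (f τ')⁻¹ * ((-1) ^ n * (f τ') * (2 * (-1) ^ n)) : ℂ) = 1 := by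
    have : (f τ')⁻¹ * f τ' = 1 := inv_mul_cancel₀ hf1
    linear_combination ((-1:ℂ) ^ n * (-1) ^ n) * this + e0
  rw [e3, one_smul] at h5
  refine h5.trans (Finset.sum_congr rfl fun l _ => ?_)
  rw [smul_smul]
  congr 1
  simp only [hb]
  ring

theorem structure_thm (N : ℕ) : ∀ τ : BRing, τ ≠ 0 → BK τ →
    (∀ j : ℕ, N < j → Psi 1 (-(j:ℤ)) τ = 0) →
    ∃ (k : ℕ) (lam : Fin k → ℕ) (c : Fin k → ℕ → ℂ) (a : ℂ), a ≠ 0 ∧ StrictAnti lam ∧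
      (∀ i, 0 < lam i ∧ lam i ≤ N) ∧
      τ = a • vac k (fun i => Psi (SS (c i)) (lam i)) 1 := by
  induction N with
  | zero =>
    intro τ h0 _ hv
    have hd : (shA τ).natDegree = 0 := by
      by_contra hd
      have h1 := Psi_lead τ
      rw [hv _ (Nat.pos_of_ne_zero hd)] at h1
      have h2 := Polynomial.leadingCoeff_eq_zero.1 h1.symm
      rw [h2] at hd; exact hd Polynomial.natDegree_zero
    obtain ⟨a, ha⟩ := const_of_deg_zero τ hd
    refine ⟨0, Fin.elim0, Fin.elim0, a, ?_, ?_, ?_, ?_⟩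
    · rintro rfl; exact h0 (by rw [ha, C_0])
    · intro i; exact i.elim0
    · intro i; exact i.elim0
    · rw [ha]; simp only [vac]; rw [smul_eq_C_mul, mul_one]
  | succ N ih =>
    intro τ h0 hBK hv
    by_cases hd : Psi 1 (-((N+1 : ℕ):ℤ)) τ = 0
    · obtain ⟨k, lam, c, a, h1, h2, h3, h4⟩ := ih τ h0 hBK (by
        intro j hj
        by_cases hj' : j = N + 1
        · subst hj'; exact hd
        · exact hv j (by omega))
      exact ⟨k, lam, c, a, h1, h2, fun i => ⟨(h3 i).1, (h3 i).2.trans (Nat.le_succ N)⟩, h4⟩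
    · obtain ⟨k, lam, c, a, h1, h2, h3, h4⟩ := ih _ hd (step_BK (N+1) (Nat.succ_pos N) τ hBK) (by
        intro j hj
        rw [psi_anti, if_neg (by omega), zero_smul, zero_sub, neg_eq_zero]
        by_cases hj' : j = N + 1
        · subst hj'; exact step_sq _ (Nat.succ_pos N) τ
        · rw [hv j (by omega), map_zero])
      obtain ⟨a', c', ha', hτ⟩ := step_form (N+1) (Nat.succ_pos N) τ hBK hv hd
      refine ⟨k + 1, Fin.cons (N+1) lam, Fin.cons c' c, a' * a, mul_ne_zero ha' h1, ?_, ?_, ?_⟩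
      · intro i j hij
        induction j using Fin.cases with
        | zero => exact absurd hij (Fin.not_lt_zero i)
        | succ j =>
          induction i using Fin.cases with
          | zero =>
            rw [Fin.cons_zero, Fin.cons_succ]
            have := (h3 j).2; omega
          | succ i =>
            rw [Fin.cons_succ, Fin.cons_succ]
            exact h2 (Fin.succ_lt_succ_iff.1 hij)
      · intro i
        induction i using Fin.cases with
        | zero => simp
        | succ i => rw [Fin.cons_succ]; exact ⟨(h3 i).1, (h3 i).2.trans (Nat.le_succ N)⟩
      · rw [hτ, h4, map_smul, smul_smul]
        rfl

end

noncomputable section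
open MvPolynomial

/-! ### Wick theorem -/

lemma vac_smul_pull (u : BRing →ₗ[ℂ] BRing) (k : ℕ) : ∀ (w : Fin (k + 1) → (BRing →ₗ[ℂ] BRing))
    (κ : Fin (k + 1) → ℂ), (∀ i p, u (w i p) + w i (u p) = κ i • p) → ∀ p,
    u (vac (k + 1) w p) = ((-1 : ℂ) ^ (k + 1)) • vac (k + 1) w (u p) +
      ∑ i : Fin (k + 1), ((-1 : ℂ) ^ (i : ℕ) * κ i) • vac k (fun j => w (i.succAbove j)) p := by
  induction k with
  | zero =>
    intro w κ h p
    simp only [vac]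
    have := h 0 p
    rw [← eq_sub_iff_add_eq] at this
    rw [this]
    simp [sub_eq_neg_add]
  | succ k ih =>
    intro w κ h p
    have h1 := ih (fun i => w i.succ) (fun i => κ i.succ) (fun i p => h i.succ p) p
    have h2 := h 0 (vac (k + 1) (fun i => w i.succ) p)
    rw [← eq_sub_iff_add_eq] at h2
    rw [vac, h2, h1, Fin.sum_univ_succ (n := k + 1), map_add, map_smul, map_sum]
    simp only [map_smul]
    have e1 : vac (k + 1) (fun j => w (Fin.succAbove 0 j)) p = vac (k + 1) (fun j => w j.succ) p := by
      simp only [Fin.zero_succAbove]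
    have e2 : ∀ i : Fin (k + 1), vac (k + 1) (fun j => w (i.succ.succAbove j)) p =
        w 0 (vac k (fun j => w (i.succAbove j).succ) p) := by
      intro i
      rw [vac, Fin.succ_succAbove_zero]
      simp only [Fin.succ_succAbove_succ]
    rw [e1]
    simp only [e2]
    have e3 : ∑ i : Fin (k + 1), ((-1 : ℂ) ^ ((i.succ : Fin (k+2)) : ℕ) * κ i.succ) •
        w 0 (vac k (fun j => w (i.succAbove j).succ) p) = - ∑ i : Fin (k + 1), ((-1 : ℂ) ^ (i : ℕ) * κ i.succ) •
        w 0 (vac k (fun j => w (i.succAbove j).succ) p) := by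
      rw [← Finset.sum_neg_distrib]
      refine Finset.sum_congr rfl fun i _ => ?_
      rw [← neg_smul]
      congr 1
      rw [Fin.val_succ, pow_succ]; ring
    rw [e3]
    have e4 : vac (k + 1 + 1) w (u p) = w 0 (vac (k + 1) (fun i => w i.succ) (u p)) := rfl
    rw [e4, pow_succ (-1 : ℂ) (k + 1), mul_neg, mul_one, neg_smul]
    simp only [Fin.val_zero, pow_zero, one_mul]
    abel

lemma ev0_add (p q : BRing) : ev0 (p + q) = ev0 p + ev0 q := by simp [ev0]
lemma ev0_smul (a : ℂ) (q : BRing) : ev0 (a • q) = a * ev0 q := by simp [ev0, smul_eq_C_mul]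
lemma ev0_mul (p q : BRing) : ev0 (p * q) = ev0 p * ev0 q := by simp [ev0]
lemma ev0_one : ev0 1 = 1 := by simp [ev0]
lemma ev0_sum {ι : Type*} (s : Finset ι) (f : ι → BRing) : ev0 (∑ i ∈ s, f i) = ∑ i ∈ s, ev0 (f i) := by
  simp [ev0]

lemma ev0_sTilde (n : ℕ) (hn : 0 < n) : ev0 (sTildeZ n) = 0 := by
  unfold sTildeZ ev0
  rw [if_pos (by omega), Int.toNat_natCast]
  have h1 := SS_map (aeval (fun _ => (0:ℂ)) : BRing →ₐ[ℂ] ℂ) tTilde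
  have h2 : (fun j => (aeval (fun _ => (0:ℂ)) : BRing →ₐ[ℂ] ℂ) (tTilde j)) = 0 := by
    funext j
    unfold tTilde
    split_ifs <;> simp
  rw [h2, SS_zero] at h1
  have h3 := congrArg (PowerSeries.coeff n) h1
  rw [PowerSeries.coeff_map, PowerSeries.coeff_one, if_neg hn.ne'] at h3
  simp only [SS, PowerSeries.coeff_mk] at h3
  exact h3

lemma sTildeZ_zero : sTildeZ 0 = 1 := by
  simp [sTildeZ, schurPoly]

lemma ev0_Psi_pos (m : ℕ) (hm : 0 < m) (p : BRing) : ev0 (Psi 1 m p) = 0 := by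
  rw [Psi_eq_sum m p _ (Nat.lt_succ_self _), ev0_sum]
  apply Finset.sum_eq_zero
  intro k _
  rw [ev0_mul]
  have : ((m : ℤ) + k) = ((m + k : ℕ) : ℤ) := by push_cast; ring
  rw [this, ev0_sTilde _ (by omega)]
  simp

lemma ev0_Psi_zero (p : BRing) : ev0 (Psi 1 0 p) = ev0 p := by
  rw [Psi_eq_sum 0 p _ (Nat.lt_succ_self _), ev0_sum, Finset.sum_eq_single 0]
  · rw [ev0_mul]
    simp [sTildeZ_zero, ev0_one, shA_coeff_zero]
  · intro k _ hk
    rw [ev0_mul, zero_add, ev0_sTilde _ (by omega)]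
    simp
  · simp

lemma Psi_zero_one : Psi 1 0 1 = 1 := by
  rw [Psi_one, ee_one, sTildeZ_zero]

/-- the Wick recursion for a given first operator -/
def WW (m : ℕ) (w : Fin (m + 1) → (BRing →ₗ[ℂ] BRing)) (v : BRing →ₗ[ℂ] BRing) : Prop :=
  ev0 (v (vac (m + 1) w 1)) = ∑ k : Fin (m + 1), (-1 : ℂ) ^ (k : ℕ) *
    (ev0 (v (w k 1)) * ev0 (vac m (fun j => w (k.succAbove j)) 1))

lemma WW_add (m : ℕ) (w : Fin (m + 1) → (BRing →ₗ[ℂ] BRing)) (v v' : BRing →ₗ[ℂ] BRing)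
    (h : WW m w v) (h' : WW m w v') : WW m w (v + v') := by
  unfold WW at *
  rw [LinearMap.add_apply, ev0_add, h, h', ← Finset.sum_add_distrib]
  refine Finset.sum_congr rfl fun k _ => ?_
  rw [LinearMap.add_apply, ev0_add]; ring

lemma WW_smul (m : ℕ) (w : Fin (m + 1) → (BRing →ₗ[ℂ] BRing)) (v : BRing →ₗ[ℂ] BRing) (a : ℂ)
    (h : WW m w v) : WW m w (a • v) := by
  unfold WW at *
  rw [LinearMap.smul_apply, ev0_smul, h, Finset.mul_sum]
  refine Finset.sum_congr rfl fun k _ => ?_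
  rw [LinearMap.smul_apply, ev0_smul]; ring

lemma WW_left (m : ℕ) (w : Fin (m + 1) → (BRing →ₗ[ℂ] BRing)) (v : BRing →ₗ[ℂ] BRing)
    (h : ∀ p, ev0 (v p) = 0) : WW m w v := by
  unfold WW
  simp [h]

lemma WW_right (m : ℕ) (w : Fin (m + 1) → (BRing →ₗ[ℂ] BRing)) (v : BRing →ₗ[ℂ] BRing)
    (κ : Fin (m + 1) → ℂ) (hκ : ∀ i p, v (w i p) + w i (v p) = κ i • p)
    (h : v 1 = 0) : WW m w v := by
  unfold WW
  have hz : ∀ (k : ℕ) (w : Fin k → (BRing →ₗ[ℂ] BRing)), vac k w 0 = 0 := by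
    intro k
    induction k with
    | zero => intro w; rfl
    | succ k ih => intro w; rw [vac, ih, map_zero]
  rw [vac_smul_pull v m w κ hκ, h, hz, smul_zero, zero_add, ev0_sum]
  refine Finset.sum_congr rfl fun k _ => ?_
  have := hκ k 1
  rw [h, map_zero, add_zero] at this
  rw [this, ev0_smul, ev0_smul, ev0_one]; ring

lemma WW_mid (m : ℕ) (hm : Even m) (w : Fin (m + 1) → (BRing →ₗ[ℂ] BRing))
    (κ : Fin (m + 1) → ℂ) (hκ : ∀ i p, Psi 1 0 (w i p) + w i (Psi 1 0 p) = κ i • p) :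
    WW m w (Psi 1 0) := by
  unfold WW
  have h1 := congrArg ev0 (vac_smul_pull (Psi 1 0) m w κ hκ 1)
  rw [ev0_add, ev0_smul, Psi_zero_one, ev0_Psi_zero, ev0_sum, hm.add_one.neg_one_pow] at h1
  have h2 : ∀ k, κ k = 2 * ev0 (w k 1) := by
    intro k
    have := congrArg ev0 (hκ k 1)
    rw [ev0_add, ev0_Psi_zero, Psi_zero_one, ev0_smul, ev0_one] at this
    linear_combination -this
  simp only [ev0_Psi_zero]
  have h3 : ∑ i : Fin (m + 1), ev0 (((-1 : ℂ) ^ (i : ℕ) * κ i) • vac m (fun j => w (i.succAbove j)) 1)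
      = 2 * ∑ k : Fin (m + 1), (-1 : ℂ) ^ (k : ℕ) *
    (ev0 (w k 1) * ev0 (vac m (fun j => w (k.succAbove j)) 1)) := by
    rw [Finset.mul_sum]
    refine Finset.sum_congr rfl fun k _ => ?_
    rw [ev0_smul, h2]; ring
  rw [h3] at h1
  linear_combination h1 / 2

lemma wick0 (m : ℕ) (hm : Even m) (f : Fin (m + 1) → PowerSeries ℂ) (n : Fin (m + 1) → ℤ)
    (g : PowerSeries ℂ) (l : ℕ) : WW m (fun i => Psi (f i) (n i)) (Psi g l) := by
  set h : PowerSeries ℂ := PowerSeries.mk fun j => PowerSeries.coeff (j + (l + 1)) g with hh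
  have hdec : g = (∑ i ∈ Finset.range l, PowerSeries.coeff i g • (PowerSeries.X : PowerSeries ℂ) ^ i +
      PowerSeries.coeff l g • PowerSeries.X ^ l) + PowerSeries.X ^ (l + 1) * h := by
    rw [← Finset.sum_range_succ (fun i => PowerSeries.coeff i g • (PowerSeries.X : PowerSeries ℂ) ^ i)]
    ext j
    rw [map_add, map_sum, PowerSeries.coeff_X_pow_mul']
    simp only [map_smul, PowerSeries.coeff_X_pow, smul_eq_mul, mul_ite, mul_one, mul_zero,
      Finset.sum_ite_eq, Finset.mem_range]
    by_cases hj : j < l + 1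
    · rw [if_pos hj, if_neg (by omega), add_zero]
    · rw [if_neg hj, if_pos (by omega), zero_add, hh, PowerSeries.coeff_mk]
      congr 2; omega
  have key : Psi g l = (Psi (∑ i ∈ Finset.range l, PowerSeries.coeff i g • (PowerSeries.X : PowerSeries ℂ) ^ i) l
      + PowerSeries.coeff l g • Psi 1 0) + Psi (PowerSeries.X ^ (l + 1) * h) l := by
    conv_lhs => rw [hdec]
    rw [Psi_add, Psi_add, Psi_smul, Psi_X_pow, sub_self]
  rw [key]
  apply WW_add
  · apply WW_add
    · apply WW_left
      intro p
      rw [Psi_sum _ _ (fun i => i), ev0_sum]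
      apply Finset.sum_eq_zero
      intro i hi
      rw [Finset.mem_range] at hi
      rw [ev0_smul]
      have : ((l : ℤ) - i) = ((l - i : ℕ) : ℤ) := by omega
      rw [this, ev0_Psi_pos _ (by omega), mul_zero]
    · apply WW_smul
      apply WW_mid m hm _ (fun i => kap 1 (f i) 0 (n i))
      intro i p
      rw [Psi_anti, smul_eq_C_mul]
  · apply WW_right m _ _ (fun i => kap _ (f i) l (n i))
    · intro i p
      rw [Psi_anti, smul_eq_C_mul]
    · rw [Psi_one, ee, cz_nat, RingHom.map_mul, map_pow, PowerSeries.map_X, mul_assoc,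
        PowerSeries.coeff_X_pow_mul', if_neg (by omega)]

/-- translation -/
def TT (c : ℕ → ℂ) : BRing →ₐ[ℂ] BRing := aeval fun i => X i + C (c i)

/-- translation parameters -/
def cchk (c : ℕ → ℂ) : ℕ → ℂ := fun j => if j % 2 = 1 then c ((j - 1) / 2) else 0

lemma TT_C (c : ℕ → ℂ) (a : ℂ) : TT c (C a) = C a := (TT c).commutes a

lemma shA_TT (c : ℕ → ℂ) (p : BRing) :
    shA (TT c p) = (shA p).map (TT c : BRing →+* BRing) := by
  have : (shA.comp (TT c) : BRing →ₐ[ℂ] Polynomial BRing) =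
      (Polynomial.mapAlgHom (TT c)).comp shA := by
    apply MvPolynomial.algHom_ext
    intro i
    have h1 : shA (C (c i)) = Polynomial.C (C (c i)) := shA.commutes _
    simp only [AlgHom.comp_apply, shA_X, map_sub, map_mul, map_pow]
    rw [Polynomial.coe_mapAlgHom, Polynomial.map_C, Polynomial.map_C, Polynomial.map_X]
    simp only [RingHom.coe_coe, TT_C]
    simp only [TT, aeval_X, map_add, shA_X, h1]
    ring
  have h2 := DFunLike.congr_fun this p
  simpa using h2

lemma map_EE_TT (c : ℕ → ℂ) : PowerSeries.map (TT c : BRing →+* BRing) EE =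
    EE * PowerSeries.map C (SS (cchk c)) := by
  have h1 : PowerSeries.map (C : ℂ →+* BRing) (SS (cchk c)) = SS fun j => C (cchk c j) :=
    SS_map (Algebra.ofId ℂ BRing) (cchk c)
  rw [h1, EE, SS_map, ← SS_add]
  congr 1
  funext j
  simp only [Pi.add_apply, tTilde, cchk]
  split_ifs
  · simp [TT]
  · simp

lemma TT_ee (c : ℕ → ℂ) (f : PowerSeries ℂ) (n : ℤ) : TT c (ee f n) = ee (f * SS (cchk c)) n := by
  unfold ee cz
  split_ifs
  · have h1 : PowerSeries.map (TT c : BRing →+* BRing) (PowerSeries.map C f * EE) =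
        PowerSeries.map C (f * SS (cchk c)) * EE := by
      rw [map_mul, map_EE_TT, map_mul]
      have : PowerSeries.map (TT c : BRing →+* BRing) (PowerSeries.map C f) = PowerSeries.map C f := by
        ext j : 1
        simp only [PowerSeries.coeff_map, RingHom.coe_coe, TT_C]
      rw [this]; ring
    rw [← h1, PowerSeries.coeff_map]; rfl
  · simp

lemma TT_Psi (c : ℕ → ℂ) (f : PowerSeries ℂ) (m : ℤ) (p : BRing) :
    TT c (Psi f m p) = Psi (f * SS (cchk c)) m (TT c p) := by
  rw [Psi_apply, Psi_apply, shA_TT]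
  have := Lam_map (TT c : BRing →+* BRing) (fun k => ee f (m + k)) (shA p)
  simp only [RingHom.coe_coe, TT_ee] at this
  exact this

lemma TT_vac (c : ℕ → ℂ) (k : ℕ) : ∀ (f : Fin k → PowerSeries ℂ) (n : Fin k → ℤ),
    TT c (vac k (fun i => Psi (f i) (n i)) 1) =
      vac k (fun i => Psi (f i * SS (cchk c)) (n i)) 1 := by
  induction k with
  | zero => intro f n; simp [vac]
  | succ k ih =>
    intro f n
    rw [vac, TT_Psi, ih (fun i => f i.succ) (fun i => n i.succ)]; rfl

lemma ev0_TT (c : ℕ → ℂ) (p : BRing) : ev0 (TT c p) = eval c p := by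
  have : ((aeval (fun _ => (0:ℂ)) : BRing →ₐ[ℂ] ℂ).comp (TT c)) = aeval c := by
    apply MvPolynomial.algHom_ext
    intro i
    simp [TT]
  exact DFunLike.congr_fun this p

theorem wick (m : ℕ) (hm : Even m) (f : Fin (m + 2) → PowerSeries ℂ) (n : Fin (m + 2) → ℕ) :
    vac (m + 2) (fun i => Psi (f i) (n i)) 1 = ∑ k : Fin (m + 1), (-1 : ℂ) ^ (k : ℕ) •
      (Psi (f 0) (n 0) (Psi (f k.succ) (n k.succ) 1) *
        vac m (fun j => Psi (f (k.succAbove j).succ) (n (k.succAbove j).succ)) 1) := by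
  apply MvPolynomial.funext
  intro c
  have h1 := wick0 m hm (fun i => f i.succ * SS (cchk c)) (fun i => (n i.succ : ℤ))
    (f 0 * SS (cchk c)) (n 0)
  unfold WW at h1
  rw [← ev0_TT, TT_vac c (m+2) f (fun i => (n i : ℤ))]
  refine h1.trans ?_
  rw [map_sum]
  refine Finset.sum_congr rfl fun k _ => ?_
  rw [smul_eq_C_mul, eval_mul, eval_mul, eval_C, ← ev0_TT c, ← ev0_TT c,
    TT_vac c m (fun j => f (k.succAbove j).succ) (fun j => (n (k.succAbove j).succ : ℤ)),
    TT_Psi, TT_Psi, map_one (TT c)]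

end

noncomputable section
open MvPolynomial

/-! ### Pfaffian expansion -/

/-- permutation built from the partner of `0` and a smaller permutation -/
def Phi (m : ℕ) (x : Fin (m + 1) × Equiv.Perm (Fin m)) : Equiv.Perm (Fin (m + 2)) :=
  Equiv.Perm.decomposeFin.symm
    (0, x.1.cycleRange.symm * Equiv.Perm.decomposeFin.symm (0, x.2))

lemma Phi_zero (m : ℕ) (x) (h : 0 < m + 2) : Phi m x ⟨0, h⟩ = 0 :=
  Equiv.Perm.decomposeFin_symm_apply_zero _ _

lemma Phi_one (m : ℕ) (x) (h : 1 < m + 2) : Phi m x ⟨1, h⟩ = x.1.succ := by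
  have : (⟨1, h⟩ : Fin (m + 2)) = (0 : Fin (m + 1)).succ := rfl
  rw [this, Phi, Equiv.Perm.decomposeFin_symm_apply_succ, Equiv.Perm.mul_apply,
    Equiv.Perm.decomposeFin_symm_apply_zero, Fin.cycleRange_symm_zero, Equiv.swap_self]
  rfl

lemma Phi_add (m : ℕ) (x) (a : ℕ) (h : a + 2 < m + 2) (h' : a < m) :
    Phi m x ⟨a + 2, h⟩ = (x.1.succAbove (x.2 ⟨a, h'⟩)).succ := by
  have : (⟨a + 2, h⟩ : Fin (m + 2)) = (⟨a, h'⟩ : Fin m).succ.succ := rfl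
  rw [this, Phi, Equiv.Perm.decomposeFin_symm_apply_succ, Equiv.Perm.mul_apply,
    Equiv.Perm.decomposeFin_symm_apply_succ, Equiv.swap_self, Equiv.swap_self, Equiv.refl_apply,
    Equiv.refl_apply, Fin.cycleRange_symm_succ]

lemma Phi_sign (m : ℕ) (x) : Equiv.Perm.sign (Phi m x) = (-1) ^ (x.1 : ℕ) * Equiv.Perm.sign x.2 := by
  rw [Phi, Equiv.Perm.decomposeFin.symm_sign, if_pos rfl, one_mul, Equiv.Perm.sign_mul,
    Equiv.Perm.decomposeFin.symm_sign, if_pos rfl, one_mul]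
  congr 1
  rw [Equiv.Perm.sign_symm, Fin.sign_cycleRange]

lemma Phi_inj (m : ℕ) : Function.Injective (Phi m) := by
  rintro ⟨k, e⟩ ⟨k', e'⟩ h
  have h1 := Equiv.Perm.decomposeFin.symm.injective h
  have hk : k = k' := by
    have := DFunLike.congr_fun h ⟨1, by omega⟩
    rw [Phi_one, Phi_one] at this
    exact Fin.succ_injective _ this
  subst hk
  have h2 := mul_left_cancel (Prod.ext_iff.1 h1).2
  have h3 := Equiv.Perm.decomposeFin.symm.injective h2
  exact Prod.ext rfl (Prod.ext_iff.1 h3).2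

lemma Phi_surj (m : ℕ) (σ : Equiv.Perm (Fin (m + 2))) (h : σ 0 = 0) : σ ∈ Set.range (Phi m) := by
  obtain ⟨⟨p, ρ⟩, rfl⟩ := Equiv.Perm.decomposeFin.symm.surjective σ
  rw [Equiv.Perm.decomposeFin_symm_apply_zero] at h
  subst h
  obtain ⟨⟨q, e⟩, he⟩ := Equiv.Perm.decomposeFin.symm.surjective ((ρ 0).cycleRange * ρ)
  have hq : q = 0 := by
    have := DFunLike.congr_fun he 0
    rw [Equiv.Perm.decomposeFin_symm_apply_zero, Equiv.Perm.mul_apply, Fin.cycleRange_self] at this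
    exact this
  subst hq
  refine ⟨(ρ 0, e), ?_⟩
  unfold Phi
  simp only
  rw [he]
  congr 2
  ext i
  simp

lemma cond_zero (m : ℕ) (hm : Even m) (σ : Equiv.Perm (Fin (m + 2))) (h : pfaffianCond σ) :
    σ 0 = 0 := by
  obtain ⟨p, hp⟩ := σ.surjective 0
  by_cases hp0 : p = 0
  · rw [hp0] at hp; exact hp
  exfalso
  obtain ⟨r, hr⟩ := hm
  obtain ⟨pv, hpv⟩ := p
  rcases Nat.even_or_odd' pv with ⟨i, hi | hi⟩
  · subst hi
    have hi0 : 0 < i := by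
      rcases Nat.eq_zero_or_pos i with h0 | h0
      · subst h0; exact absurd rfl hp0
      · exact h0
    have := h.2 ⟨0, by omega⟩ ⟨i, by omega⟩ (by simpa using hi0)
    simp only [hp] at this
    exact absurd this (Fin.not_lt_zero _)
  · subst hi
    have := h.1 ⟨i, by omega⟩
    simp only [hp] at this
    exact absurd this (Fin.not_lt_zero _)

lemma Phi_cond (m : ℕ) (x) : pfaffianCond (Phi m x) ↔ pfaffianCond x.2 := by
  have hd : (m + 2) / 2 = m / 2 + 1 := by omega
  constructor
  · rintro ⟨h1, h2⟩
    refine ⟨fun i => ?_, fun i j hij => ?_⟩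
    · have hi := i.isLt
      have := h1 ⟨i.val + 1, by omega⟩
      have e1 := Phi_add m x (2 * i.val) (by omega) (by omega)
      have e2 := Phi_add m x (2 * i.val + 1) (by omega) (by omega)
      have this' : Phi m x ⟨2 * i.val + 2, by omega⟩ < Phi m x ⟨2 * i.val + 1 + 2, by omega⟩ := this
      rw [e1, e2, Fin.succ_lt_succ_iff, Fin.succAbove_lt_succAbove_iff] at this'
      exact this'
    · have hi := i.isLt
      have hj := j.isLt
      have := h2 ⟨i.val + 1, by omega⟩ ⟨j.val + 1, by omega⟩ (by
        simp only [Fin.mk_lt_mk]; exact Nat.succ_lt_succ hij)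
      have e1 := Phi_add m x (2 * i.val) (by omega) (by omega)
      have e2 := Phi_add m x (2 * j.val) (by omega) (by omega)
      have this' : Phi m x ⟨2 * i.val + 2, by omega⟩ < Phi m x ⟨2 * j.val + 2, by omega⟩ := this
      rw [e1, e2, Fin.succ_lt_succ_iff, Fin.succAbove_lt_succAbove_iff] at this'
      exact this'
  · rintro ⟨h1, h2⟩
    refine ⟨?_, ?_⟩
    · rintro ⟨i, hi⟩
      cases i with
      | zero =>
        have e1 := Phi_zero m x (by omega)
        have e2 := Phi_one m x (by omega)
        change Phi m x ⟨0, _⟩ < Phi m x ⟨1, _⟩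
        rw [e1, e2]
        exact Fin.succ_pos _
      | succ i =>
        have e1 := Phi_add m x (2 * i) (by omega) (by omega)
        have e2 := Phi_add m x (2 * i + 1) (by omega) (by omega)
        change Phi m x ⟨2 * i + 2, _⟩ < Phi m x ⟨2 * i + 1 + 2, _⟩
        rw [e1, e2, Fin.succ_lt_succ_iff, Fin.succAbove_lt_succAbove_iff]
        exact h1 ⟨i, by omega⟩
    · rintro ⟨i, hi⟩ ⟨j, hj⟩ hij
      simp only [Fin.mk_lt_mk] at hij
      cases j with
      | zero => omega
      | succ j =>
        have e2 := Phi_add m x (2 * j) (by omega) (by omega)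
        cases i with
        | zero =>
          have e1 := Phi_zero m x (by omega)
          change Phi m x ⟨0, _⟩ < Phi m x ⟨2 * j + 2, _⟩
          rw [e1, e2]
          exact Fin.succ_pos _
        | succ i =>
          have e1 := Phi_add m x (2 * i) (by omega) (by omega)
          change Phi m x ⟨2 * i + 2, _⟩ < Phi m x ⟨2 * j + 2, _⟩
          rw [e1, e2, Fin.succ_lt_succ_iff, Fin.succAbove_lt_succAbove_iff]
          exact h2 ⟨i, by omega⟩ ⟨j, by omega⟩ (by simp only [Fin.mk_lt_mk]; omega)

lemma Phi_prod {R : Type*} [CommRing R] (m : ℕ) (x) (A : Matrix (Fin (m + 2)) (Fin (m + 2)) R) :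
    ∏ i : Fin ((m + 2) / 2), A (Phi m x ⟨2 * i.val, by have := i.isLt; omega⟩)
            (Phi m x ⟨2 * i.val + 1, by have := i.isLt; omega⟩) =
    A 0 x.1.succ * ∏ i : Fin (m / 2),
      A (x.1.succAbove (x.2 ⟨2 * i.val, by have := i.isLt; omega⟩)).succ
        (x.1.succAbove (x.2 ⟨2 * i.val + 1, by have := i.isLt; omega⟩)).succ := by
  have hd : m / 2 + 1 = (m + 2) / 2 := by omega
  rw [← Fintype.prod_equiv (finCongr hd) (fun i : Fin (m / 2 + 1) =>
      A (Phi m x ⟨2 * i.val, by have := i.isLt; omega⟩)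
            (Phi m x ⟨2 * i.val + 1, by have := i.isLt; omega⟩)) _ (fun i => rfl),
    Fin.prod_univ_succ]
  congr 1
  · have e1 := Phi_zero m x (by omega)
    have e2 := Phi_one m x (by omega)
    change A (Phi m x ⟨0, _⟩) (Phi m x ⟨1, _⟩) = _
    rw [e1, e2]
  · refine Finset.prod_congr rfl fun i _ => ?_
    have hi := i.isLt
    have e1 := Phi_add m x (2 * i.val) (by omega) (by omega)
    have e2 := Phi_add m x (2 * i.val + 1) (by omega) (by omega)
    rw [← e1, ← e2]
    rfl

theorem pfaffian_expand {R : Type*} [CommRing R] (m : ℕ) (hm : Even m)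
    (A : Matrix (Fin (m + 2)) (Fin (m + 2)) R) :
    pfaffian A = ∑ k : Fin (m + 1), (-1 : R) ^ (k : ℕ) *
      (A 0 k.succ * pfaffian (A.submatrix (fun i => (k.succAbove i).succ)
        (fun i => (k.succAbove i).succ))) := by
  classical
  unfold pfaffian
  simp only [Finset.mul_sum]
  rw [← Fintype.sum_prod_type']
  symm
  apply Fintype.sum_of_injective (Phi m) (Phi_inj m)
  · intro σ hσ
    rw [if_neg]
    intro hc
    exact hσ (Phi_surj m σ (cond_zero m hm σ hc))
  · rintro ⟨k, e⟩
    have hc := Phi_cond m (k, e)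
    by_cases h : pfaffianCond e
    · rw [if_pos h, if_pos (hc.2 h), Phi_prod, Phi_sign]
      simp only [Matrix.submatrix_apply, zsmul_eq_mul]
      push_cast
      ring
    · rw [if_neg h, if_neg (fun h' => h (hc.1 h'))]
      simp

/-! ### final assembly -/

lemma ee_SS (c : ℕ → ℂ) (n : ℕ) : ee (SS c) n = sB n (tShift c) := by
  have h1 : PowerSeries.map (C : ℂ →+* BRing) (SS c) = SS fun j => C (c j) :=
    SS_map (Algebra.ofId ℂ BRing) c
  rw [ee, cz_nat, h1, EE, mul_comm, ← SS_add, SS, PowerSeries.coeff_mk]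
  rfl

lemma two_chi (l μ : ℕ) (c c' : ℕ → ℂ) :
    Psi (SS c) l (Psi (SS c') μ 1) = (2 : ℂ) • chiB l μ (tShift c) (tShift c') := by
  rw [Psi_Psi_one _ _ _ _ (μ + 1) (by push_cast; omega), chiB, smul_add, smul_smul,
    Finset.sum_range_succ', add_comm, Finset.smul_sum]
  congr 1
  · have h1 := ee_SS c l
    have h2 := ee_SS c' μ
    simp only [Nat.cast_zero, add_zero, sub_zero, h1, h2, qq, if_true]
    norm_num
  · rw [Finset.range_eq_Ico, Finset.sum_Ico_add' (fun k => C (qq k) * (ee (SS c) ((l:ℤ) + (k:ℕ)) *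
      ee (SS c') ((μ:ℤ) - (k:ℕ)))) 0 μ 1, zero_add]
    refine Finset.sum_congr (by ext; simp only [Finset.mem_Ico, Finset.mem_Icc]; omega) fun k hk => ?_
    rw [Finset.mem_Icc] at hk
    have e1 : (l:ℤ) + k = ((l + k : ℕ) : ℤ) := by push_cast; rfl
    have e2 : (μ:ℤ) - k = ((μ - k : ℕ) : ℤ) := by omega
    rw [e1, e2, ee_SS, ee_SS, qq, if_neg (by omega), ← smul_eq_C_mul, smul_smul]

lemma chi_sub {m : ℕ} (lam : Fin (m + 2) → ℕ) (c : Fin (m + 2) → ℕ → ℂ) (k : Fin (m + 1)) :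
    (chiMatrix lam c).submatrix (fun i => (k.succAbove i).succ) (fun i => (k.succAbove i).succ) =
    chiMatrix (fun i => lam (k.succAbove i).succ) (fun i => c (k.succAbove i).succ) := by
  ext1 i j
  simp only [chiMatrix, skewOf, Matrix.submatrix_apply, Matrix.of_apply, Fin.succ_lt_succ_iff,
    Fin.succAbove_lt_succAbove_iff]

theorem vac_pf (n : ℕ) : ∀ (m : ℕ), m = 2 * n → ∀ (lam : Fin m → ℕ) (c : Fin m → ℕ → ℂ),
    vac m (fun i => Psi (SS (c i)) (lam i)) 1 = ((2 : ℂ) ^ n) • pfaffian (chiMatrix lam c) := by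
  induction n with
  | zero =>
    intro m hm lam c
    subst hm
    have h : pfaffian (chiMatrix lam c) = 1 := by
      unfold pfaffian
      rw [Fintype.sum_eq_single (1 : Equiv.Perm (Fin (2 * 0)))]
      · rw [if_pos]
        · simp
        · exact ⟨fun i => absurd i.isLt (by omega), fun i => absurd i.isLt (by omega)⟩
      · intro σ hσ
        exact absurd (Equiv.ext fun i => absurd i.isLt (by omega)) hσ
    rw [h, pow_zero, one_smul]
    rfl
  | succ n ih =>
    intro m hm lam c
    obtain ⟨m, rfl⟩ : ∃ m', m = m' + 2 := ⟨2 * n, by omega⟩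
    have hm' : m = 2 * n := by omega
    have hev : Even m := ⟨n, by omega⟩
    rw [wick m hev (fun i => SS (c i)) lam, pfaffian_expand m hev, Finset.smul_sum]
    refine Finset.sum_congr rfl fun k _ => ?_
    rw [chi_sub, two_chi, ih m hm' (fun i => lam (k.succAbove i).succ) (fun i => c (k.succAbove i).succ)]
    have : chiMatrix lam c 0 k.succ =
        chiB (lam 0) (lam k.succ) (tShift (c 0)) (tShift (c k.succ)) := by
      simp only [chiMatrix, skewOf, Matrix.of_apply]
      rw [if_pos (Fin.succ_pos k)]
    rw [this]
    simp only [smul_eq_C_mul, C_mul, map_pow, map_neg, map_one, pow_succ]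
    ring

lemma vac_snoc (k : ℕ) : ∀ (v : Fin k → (BRing →ₗ[ℂ] BRing)) (u : BRing →ₗ[ℂ] BRing) (p : BRing),
    vac (k + 1) (Fin.snoc (α := fun _ => BRing →ₗ[ℂ] BRing) v u) p = vac k v (u p) := by
  induction k with
  | zero => intro v u p; rfl
  | succ k ih =>
    intro v u p
    have h1 : (fun i : Fin (k + 1) => (Fin.snoc (α := fun _ => BRing →ₗ[ℂ] BRing) v u :
        Fin (k + 2) → (BRing →ₗ[ℂ] BRing)) i.succ) =
        Fin.snoc (α := fun _ => BRing →ₗ[ℂ] BRing) (fun i => v i.succ) u := by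
      funext i
      induction i using Fin.lastCases with
      | last => rw [Fin.succ_last, Fin.snoc_last, Fin.snoc_last]
      | cast i => rw [Fin.succ_castSucc, Fin.snoc_castSucc, Fin.snoc_castSucc]
    have h0 : (Fin.snoc (α := fun _ => BRing →ₗ[ℂ] BRing) v u :
        Fin (k + 2) → (BRing →ₗ[ℂ] BRing)) 0 = v 0 := by
      rw [← Fin.castSucc_zero, Fin.snoc_castSucc]
    rw [vac, h1, h0, ih]
    rfl

lemma snoc_ext (k : ℕ) (lam : Fin k → ℕ) (c : Fin k → ℕ → ℂ) (hl : StrictAnti lam)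
    (hp : ∀ i, 0 < lam i) : ∃ (lam' : Fin (k + 1) → ℕ) (c' : Fin (k + 1) → ℕ → ℂ),
    StrictAnti lam' ∧ vac (k + 1) (fun i => Psi (SS (c' i)) (lam' i)) 1 =
      vac k (fun i => Psi (SS (c i)) (lam i)) 1 := by
  refine ⟨Fin.snoc (α := fun _ => ℕ) lam 0, Fin.snoc (α := fun _ => ℕ → ℂ) c 0, ?_, ?_⟩
  · intro i j hij
    induction i using Fin.lastCases with
    | last => exact absurd hij (not_lt.2 (Fin.le_last _))
    | cast i =>
      rw [Fin.snoc_castSucc]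
      induction j using Fin.lastCases with
      | last => rw [Fin.snoc_last]; exact hp i
      | cast j =>
        rw [Fin.snoc_castSucc]
        exact hl (Fin.castSucc_lt_castSucc_iff.1 hij)
  · have h1 : (fun i : Fin (k + 1) => Psi (SS ((Fin.snoc (α := fun _ => ℕ → ℂ) c 0 : Fin (k + 1) → ℕ → ℂ) i))
        ((Fin.snoc (α := fun _ => ℕ) lam 0 : Fin (k + 1) → ℕ) i)) =
        Fin.snoc (α := fun _ => BRing →ₗ[ℂ] BRing) (fun i => Psi (SS (c i)) (lam i)) (Psi 1 0) := by
      funext i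
      induction i using Fin.lastCases with
      | last =>
        rw [Fin.snoc_last, Fin.snoc_last, Fin.snoc_last, SS_zero, Nat.cast_zero]
      | cast i =>
        rw [Fin.snoc_castSucc, Fin.snoc_castSucc, Fin.snoc_castSucc]
    rw [h1, vac_snoc, Psi_zero_one]

theorem final_thm (τ : BRing) (hτ : τ ≠ 0) (h : SatisfiesBKP τ) :
    ∃ (n : ℕ) (lam : Fin (2 * n) → ℕ) (_ : StrictAnti lam)
      (c : Fin (2 * n) → ℕ → ℂ) (a : ℂ),
      a ≠ 0 ∧ τ = a • pfaffian (chiMatrix lam c) := by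
  obtain ⟨k, lam, c, a, ha, hl, hp, hτe⟩ := structure_thm (shA τ).natDegree τ hτ (BK_of τ h)
    (fun j hj => Psi_low _ _ (by omega))
  have key : ∃ (n m : ℕ) (_ : m = 2 * n) (lam : Fin m → ℕ) (c : Fin m → ℕ → ℂ), StrictAnti lam ∧
      τ = a • vac m (fun i => Psi (SS (c i)) (lam i)) 1 := by
    rcases Nat.even_or_odd' k with ⟨n, hn | hn⟩
    · exact ⟨n, k, hn, lam, c, hl, hτe⟩
    · obtain ⟨lam', c', h1, h2⟩ := snoc_ext k lam c hl (fun i => (hp i).1)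
      exact ⟨n + 1, k + 1, by omega, lam', c', h1, by rw [h2]; exact hτe⟩
  obtain ⟨n, m, rfl, lam, c, h1, h2⟩ := key
  refine ⟨n, lam, h1, c, a * 2 ^ n, mul_ne_zero ha (pow_ne_zero _ two_ne_zero), ?_⟩
  rw [mul_smul, ← vac_pf n _ rfl]
  exact h2

end

noncomputable section

/-- Every nonzero polynomial `τ ∈ ℂ[t₁,t₃,t₅,…]` satisfying the BKP
bilinear identity is of the form `τ = a · Pf( χ_{λ_i,λ_j}(t̃+c_i, t̃+c_j) )_{1≤i,j≤2n}`
for some `n ≥ 0`, integers `λ_1 > ⋯ > λ_{2n} ≥ 0`, sequences `c_1, …, c_{2n}` of complex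
numbers, and a nonzero scalar `a ∈ ℂ`. -/
theorem polynomial_tau_BKP_classification (τ : BRing) (hτ : τ ≠ 0) (h : SatisfiesBKP τ) :
    ∃ (n : ℕ) (lam : Fin (2 * n) → ℕ) (_ : StrictAnti lam)
      (c : Fin (2 * n) → ℕ → ℂ) (a : ℂ),
      a ≠ 0 ∧ τ = a • pfaffian (chiMatrix lam c) := by
  exact final_thm τ hτ h

end
end
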